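/- arXiv:2505.03221 — 5 statements merged into one kernel-verified Lean document; each statement's English description precedes it below -/
import Mathlib

section
/- Let f : ℂ → ℂ be entire of exponential type τ > 0, even, with f|ℝ Lebesgue integrable. Let m ≥ 0 be an integer and let λ > τ be real. Then ∫₀^∞ f(x)·sin^{2m+1}(λx)/x^{2m+1} dx = ((−1)^m · π · (2m+1)! / 2^{2m+1}) · Σ_{l=0}^{m} D_{l,m} · λ^{2l}, where D_{l,m} = ((−1)^l · f^{(2m−2l)}(0) / ((2l)!·(2m−2l)!)) · Σ_{k=0}^{m} (−1)^k · (2m−2k+1)^{2l} / (k!·(2m+1−k)!). In particular the left-hand side is an exact polynomial in λ of degree 2m for all λ > τ (Theorem 2). -/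
open MeasureTheory Filter Nat

/-- Phragmen-Lindelof in the upper half plane. -/
lemma pl_upper (Φ : ℂ → ℂ) (hΦ : Differentiable ℂ Φ) (C σ K : ℝ)
    (hC : ∀ z : ℂ, ‖Φ z‖ ≤ C * Real.exp (σ * ‖z‖)) (hK : ∀ x : ℝ, ‖Φ x‖ ≤ K)
    (z : ℂ) (hz : 0 ≤ z.im) : ‖Φ z‖ ≤ K * Real.exp (σ * z.im) := by
  set q : ℂ → ℂ := fun w => Φ (Complex.I * w) * Complex.exp (-(σ : ℂ) * w) with hq
  have hqd : Differentiable ℂ q := by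
    have : Differentiable ℂ fun w => Φ (Complex.I * w) := hΦ.comp (by fun_prop)
    exact this.mul (by fun_prop)
  have hqn : ∀ w : ℂ, ‖q w‖ = ‖Φ (Complex.I * w)‖ * Real.exp (-σ * w.re) := by
    intro w
    simp [hq, Complex.norm_exp]
  have key : ‖q (-Complex.I * z)‖ ≤ K := by
    apply PhragmenLindelof.right_half_plane_of_bounded_on_real (f := q) hqd.diffContOnCl
    · refine ⟨1, by norm_num, 2 * |σ|, ?_⟩
      refine Asymptotics.IsBigO.of_bound C (Eventually.of_forall fun w => ?_)
      rw [hqn, Real.norm_eq_abs, Real.abs_exp, Real.rpow_one]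
      have h1 := hC (Complex.I * w)
      have hC0 : 0 ≤ C := by
        have := (norm_nonneg _).trans (hC 0)
        simpa using this
      calc _ ≤ (C * Real.exp (σ * ‖Complex.I * w‖)) * Real.exp (-σ * w.re) := by gcongr
        _ = C * Real.exp (σ * ‖w‖ + -σ * w.re) := by
          rw [Real.exp_add]; simp; ring
        _ ≤ _ := by
          gcongr
          have h2 := Complex.abs_re_le_norm w
          have h3 : -σ * w.re ≤ |σ| * ‖w‖ := by
            calc -σ * w.re ≤ |-σ * w.re| := le_abs_self _
              _ = |σ| * |w.re| := by rw [abs_mul, abs_neg]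
              _ ≤ _ := by gcongr
          have h4 : σ * ‖w‖ ≤ |σ| * ‖w‖ := by gcongr; exact le_abs_self _
          linarith
    · refine ⟨C, ?_⟩
      rw [eventually_map]
      filter_upwards [eventually_ge_atTop 0] with x hx
      rw [hqn]
      have h1 := hC (Complex.I * x)
      calc _ ≤ (C * Real.exp (σ * ‖Complex.I * x‖)) * Real.exp (-σ * (x : ℂ).re) := by gcongr
        _ = C := by
          rw [mul_assoc, ← Real.exp_add]; simp [abs_of_nonneg hx]
    · intro x
      rw [hqn]
      have := hK (-x)
      simpa [mul_comm, mul_assoc, ← mul_assoc Complex.I] using this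
    · simpa using hz
  rw [hqn, ← mul_assoc] at key
  simp only [mul_neg, Complex.I_mul_I, neg_neg, one_mul] at key
  have e : (-Complex.I * z).re = z.im := by simp
  rw [e] at key
  calc ‖Φ z‖ = ‖Φ z‖ * Real.exp (-σ * z.im) * Real.exp (σ * z.im) := by
        rw [mul_assoc, ← Real.exp_add]; simp
    _ ≤ _ := by gcongr

lemma pl_all (Φ : ℂ → ℂ) (hΦ : Differentiable ℂ Φ) (C σ K : ℝ)
    (hC : ∀ z : ℂ, ‖Φ z‖ ≤ C * Real.exp (σ * ‖z‖)) (hK : ∀ x : ℝ, ‖Φ x‖ ≤ K)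
    (z : ℂ) : ‖Φ z‖ ≤ K * Real.exp (σ * |z.im|) := by
  rcases le_total 0 z.im with h | h
  · rw [abs_of_nonneg h]; exact pl_upper Φ hΦ C σ K hC hK z h
  · rw [abs_of_nonpos h]
    have := pl_upper (fun w => Φ (-w)) (hΦ.comp differentiable_neg) C σ K
      (fun z => by simpa using hC (-z)) (fun x => by simpa using hK (-x)) (-z) (by simpa using h)
    simpa using this

lemma growth (f : ℂ → ℂ) (τ : ℝ) (hτ : 0 < τ)
    (hf : Differentiable ℂ f)
    (htype : ∀ ε > 0, ∃ C > 0, ∀ z : ℂ, ‖f z‖ ≤ C * Real.exp ((τ + ε) * ‖z‖))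
    (hint : Integrable (fun x : ℝ => f x)) (σ : ℝ) (hσ : τ < σ) :
    ∃ M > 0, ∀ z : ℂ, ‖f z‖ ≤ M * Real.exp (σ * |z.im|) := by
  obtain ⟨Φ, hΦ0, hΦ⟩ := hf.isExactOn_univ.with_val_at 0 0
  have hΦ' : ∀ z, HasDerivAt Φ (f z) z := fun z => hΦ z (Set.mem_univ z)
  have hΦd : Differentiable ℂ Φ := fun z => (hΦ' z).differentiableAt
  obtain ⟨C, hC0, hC⟩ := htype ((σ - τ) / 2) (by linarith)
  set δ := (σ - τ) / 2 with hδ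
  have hδ0 : 0 < δ := by linarith
  have hb : ∀ z : ℂ, ‖Φ z‖ ≤ (C / δ) * Real.exp (σ * ‖z‖) := by
    intro z
    have h := (convex_closedBall (0 : ℂ) ‖z‖).norm_image_sub_le_of_norm_hasDerivWithin_le
      (f := Φ) (f' := f) (C := C * Real.exp ((τ + δ) * ‖z‖)) (x := 0) (y := z)
      (fun w _ => (hΦ' w).hasDerivWithinAt) (fun w hw => (hC w).trans (by
        have : ‖w‖ ≤ ‖z‖ := by simpa using hw
        gcongr)) (by simp) (by simp)
    rw [hΦ0, sub_zero, sub_zero] at h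
    refine h.trans ?_
    have h1 : δ * ‖z‖ ≤ Real.exp (δ * ‖z‖) := by linarith [Real.add_one_le_exp (δ * ‖z‖)]
    have h2 : σ * ‖z‖ = (τ + δ) * ‖z‖ + δ * ‖z‖ := by rw [hδ]; ring
    rw [h2, Real.exp_add]
    calc C * Real.exp ((τ + δ) * ‖z‖) * ‖z‖
        = C / δ * (Real.exp ((τ + δ) * ‖z‖) * (δ * ‖z‖)) := by field_simp
      _ ≤ _ := by gcongr
  have hK : ∀ x : ℝ, ‖Φ x‖ ≤ ∫ t : ℝ, ‖f t‖ := by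
    intro x
    have h := intervalIntegral.integral_eq_sub_of_hasDerivAt (a := 0) (b := x)
      (f := fun t : ℝ => Φ t) (f' := fun t : ℝ => f t)
      (fun t _ => (hΦ' t).comp_ofReal) hint.intervalIntegrable
    simp only [Complex.ofReal_zero, hΦ0, sub_zero] at h
    rw [← h]
    refine intervalIntegral.norm_integral_le_integral_norm_uIoc.trans ?_
    exact setIntegral_le_integral hint.norm (Eventually.of_forall fun _ => norm_nonneg _)
  set K := ∫ t : ℝ, ‖f t‖ with hKdef
  have hK0 : 0 ≤ K := integral_nonneg fun _ => norm_nonneg _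
  refine ⟨(K + 1) * Real.exp σ, by positivity, fun z => ?_⟩
  have h := Complex.norm_deriv_le_of_forall_mem_sphere_norm_le (c := z) (R := 1) (f := Φ)
    (C := (K + 1) * Real.exp (σ * (|z.im| + 1))) one_pos hΦd.diffContOnCl (fun w hw => by
      refine (pl_all Φ hΦd _ σ K hb hK w).trans ?_
      have : |w.im| ≤ |z.im| + 1 := by
        have h1 : |(w - z).im| ≤ 1 := by
          refine (Complex.abs_im_le_norm _).trans ?_
          rw [mem_sphere_iff_norm] at hw
          exact hw.le
        have : w.im = z.im + (w - z).im := by simp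
        rw [this]
        exact (abs_add_le _ _).trans (by linarith)
      have : 0 < σ := by linarith
      gcongr
      linarith)
  rw [(hΦ' z).deriv, div_one] at h
  refine h.trans (le_of_eq ?_)
  rw [mul_assoc, ← Real.exp_add]
  ring_nf

open Complex in
lemma contour (W : ℂ → ℂ) (hW : Differentiable ℂ W) (m : ℕ) (M c : ℝ) (hc : 0 < c)
    (hb : ∀ z : ℂ, 0 ≤ z.im → ‖W z‖ ≤ M * Real.exp (-c * z.im))
    (hodd : Tendsto (fun z : ℂ => (W z - W (-z)) / z ^ (2 * m)) (nhdsWithin 0 {0}ᶜ) (nhds 0))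
    (hint : IntegrableOn (fun x : ℝ => (W x - W (-x)) / (x : ℂ) ^ (2 * m + 1)) (Set.Ioi 0)) :
    ∫ x in Set.Ioi (0 : ℝ), (W x - W (-x)) / (x : ℂ) ^ (2 * m + 1)
      = I * Real.pi * (iteratedDeriv (2 * m) W 0 / ((2 * m)! : ℂ)) := by
  set w := iteratedDeriv (2 * m) W 0 / ((2 * m)! : ℂ) with hw
  set G : ℂ → ℂ := fun s => W (exp s) / exp s ^ (2 * m) with hG
  have hM : 0 ≤ M := by
    have := (norm_nonneg _).trans (hb 0 (by simp))
    simpa using this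
  have hGd : Differentiable ℂ G := by
    have : Differentiable ℂ fun s => W (exp s) := hW.comp differentiable_exp
    exact this.div (by fun_prop) (fun s => pow_ne_zero _ (exp_ne_zero s))
  have hGc : Continuous G := hGd.continuous
  have hGpi : ∀ s, G (s + Real.pi * I) = W (-exp s) / exp s ^ (2 * m) := by
    intro s
    simp [hG, exp_add, exp_pi_mul_I, pow_mul]
  set J : ℝ → ℂ := fun s => ∫ θ in (0 : ℝ)..Real.pi, G (s + θ * I) with hJ
  have step1 : ∀ a b : ℝ, ∫ s in a..b, (G s - G (s + Real.pi * I)) = I * (J a - J b) := by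
    intro a b
    have h := integral_boundary_rect_eq_zero_of_differentiableOn G (a : ℂ) (b + Real.pi * I)
      hGd.differentiableOn
    simp only [ofReal_re, ofReal_im, add_re, add_im, mul_re, mul_im, I_re, I_im, mul_zero, mul_one,
      sub_zero, zero_add, add_zero, ofReal_zero, zero_mul, smul_eq_mul] at h
    rw [intervalIntegral.integral_sub
      (Continuous.intervalIntegrable (by fun_prop) _ _)
      (Continuous.intervalIntegrable (by fun_prop) _ _)]
    simp only [hJ]
    linear_combination h
  have step2 : Tendsto J atTop (nhds 0) := by
    have h0 : (0 : ℂ) = ∫ θ in (0 : ℝ)..Real.pi, (0 : ℂ) := by simp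
    rw [h0]
    have hbd : ∀ s : ℝ, 0 ≤ s → ∀ θ : ℝ, θ ∈ Set.Icc 0 Real.pi →
        ‖G (s + θ * I)‖ ≤ M * Real.exp (-c * (Real.exp s * Real.sin θ)) := by
      intro s hs θ hθ
      have him : (exp (s + θ * I)).im = Real.exp s * Real.sin θ := by
        rw [exp_im]; simp
      have hn : ‖exp (s + θ * I)‖ = Real.exp s := by rw [norm_exp]; simp
      have hsin : 0 ≤ Real.sin θ := Real.sin_nonneg_of_mem_Icc hθ
      have h1 := hb (exp (s + θ * I)) (by rw [him]; positivity)
      rw [him] at h1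
      simp only [hG, norm_div, norm_pow, hn]
      refine (div_le_self (norm_nonneg _) ?_).trans h1
      exact one_le_pow₀ (Real.one_le_exp hs)
    apply intervalIntegral.tendsto_integral_filter_of_dominated_convergence (fun _ => M)
    · exact Eventually.of_forall fun s =>
        (Continuous.aestronglyMeasurable (by fun_prop))
    · filter_upwards [eventually_ge_atTop 0] with s hs
      refine Eventually.of_forall fun θ hθ => ?_
      rw [Set.uIoc_of_le Real.pi_pos.le] at hθ
      refine (hbd s hs θ ⟨hθ.1.le, hθ.2⟩).trans ?_
      have hsin : 0 ≤ Real.sin θ := Real.sin_nonneg_of_mem_Icc ⟨hθ.1.le, hθ.2⟩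
      refine mul_le_of_le_one_right hM (Real.exp_le_one_iff.2 ?_)
      have : 0 ≤ c * (Real.exp s * Real.sin θ) := by positivity
      linarith
    · exact intervalIntegrable_const
    · have hne : ∀ᵐ θ : ℝ, θ ≠ Real.pi := by
        simp [ae_iff, measure_singleton]
      filter_upwards [hne] with θ hne hθ
      rw [Set.uIoc_of_le Real.pi_pos.le] at hθ
      have hsin : 0 < Real.sin θ := Real.sin_pos_of_pos_of_lt_pi hθ.1 (lt_of_le_of_ne hθ.2 hne)
      have ht : Tendsto (fun s : ℝ => M * Real.exp (-c * (Real.exp s * Real.sin θ))) atTop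
          (nhds 0) := by
        rw [← mul_zero M]
        refine Tendsto.const_mul M (Real.tendsto_exp_atBot.comp ?_)
        exact (Real.tendsto_exp_atTop.atTop_mul_const hsin).const_mul_atTop_of_neg (by linarith)
      refine squeeze_zero_norm' ?_ ht
      filter_upwards [eventually_ge_atTop 0] with s hs
      exact hbd s hs θ ⟨hθ.1.le, hθ.2⟩
  have step3 : Tendsto J atBot (nhds (Real.pi * w)) := by
    have hfull : ∀ s : ℝ, ∫ θ in (0 : ℝ)..(2 * Real.pi), G (s + θ * I) = 2 * Real.pi * w := by
      intro s
      have h := (hW.diffContOnCl (s := Metric.ball 0 (Real.exp s))).circleIntegral_one_div_sub_center_pow_smul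
        (Real.exp_pos s) (2 * m)
      rw [circleIntegral] at h
      have e : ∀ θ : ℝ, deriv (circleMap 0 (Real.exp s)) θ •
          (fun z : ℂ => (1 / (z - 0) ^ (2 * m + 1)) • W z) (circleMap 0 (Real.exp s) θ)
          = I * G (s + θ * I) := by
        intro θ
        have : circleMap 0 (Real.exp s) θ = exp (s + θ * I) := by
          simp [circleMap, exp_add]
        simp only [deriv_circleMap, sub_zero, smul_eq_mul, hG, this]
        have h0 := exp_ne_zero (s + θ * I)
        rw [pow_succ]
        field_simp
      simp only [] at e
      rw [intervalIntegral.integral_congr (fun θ _ => e θ)] at h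
      simp only [ intervalIntegral.integral_const_mul, smul_eq_mul] at h
      apply mul_left_cancel₀ I_ne_zero
      rw [h, hw]
      ring
    have hsplit : ∀ s : ℝ, J s = Real.pi * w +
        (1 / 2) * ∫ θ in (0 : ℝ)..Real.pi, (G (s + θ * I) - G (s + θ * I + Real.pi * I)) := by
      intro s
      have h1 := hfull s
      rw [← intervalIntegral.integral_add_adjacent_intervals (b := Real.pi)
        (Continuous.intervalIntegrable (by fun_prop) _ _)
        (Continuous.intervalIntegrable (by fun_prop) _ _)] at h1
      have h2 : ∫ θ in Real.pi..(2 * Real.pi), G (s + θ * I)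
          = ∫ θ in (0 : ℝ)..Real.pi, G (s + θ * I + Real.pi * I) := by
        have := intervalIntegral.integral_comp_add_right (a := 0) (b := Real.pi)
          (fun θ : ℝ => G (s + θ * I)) Real.pi
        rw [zero_add, ← two_mul] at this
        rw [← this]
        congr 1
        ext θ
        push_cast
        ring_nf
      rw [intervalIntegral.integral_sub
        (Continuous.intervalIntegrable (by fun_prop) _ _)
        (Continuous.intervalIntegrable (by fun_prop) _ _), ← h2]
      simp only [hJ]
      linear_combination (1 / 2) * h1
    have hz : Tendsto (fun s : ℝ => ∫ θ in (0 : ℝ)..Real.pi,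
        (G (s + θ * I) - G (s + θ * I + Real.pi * I))) atBot (nhds 0) := by
      rw [Metric.tendsto_nhds]
      intro ε hε
      have h1 := (Metric.tendsto_nhdsWithin_nhds.1 hodd) (ε / (2 * Real.pi)) (by positivity)
      obtain ⟨δ, hδ, h1⟩ := h1
      have h2 := Real.tendsto_exp_atBot.eventually (gt_mem_nhds hδ)
      filter_upwards [h2] with s hs
      rw [_root_.dist_zero_right]
      have h3 : ‖∫ θ in (0 : ℝ)..Real.pi, (G (s + θ * I) - G (s + θ * I + Real.pi * I))‖ ≤
          (ε / (2 * Real.pi)) * |Real.pi - 0| := by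
        apply intervalIntegral.norm_integral_le_of_norm_le_const
        intro θ _
        have hn : ‖exp (s + θ * I)‖ = Real.exp s := by rw [norm_exp]; simp
        have h4 := h1 (x := exp (s + θ * I)) (exp_ne_zero _) (by
          rw [_root_.dist_zero_right, hn]; exact hs)
        rw [_root_.dist_zero_right] at h4
        rw [hGpi]
        simp only [hG, ← sub_div]
        exact h4.le
      refine h3.trans_lt ?_
      rw [sub_zero, abs_of_pos Real.pi_pos]
      have := Real.pi_pos
      have : ε / (2 * Real.pi) * Real.pi = ε / 2 := by field_simp
      linarith
    have := (hz.const_mul (1 / 2 : ℂ)).const_add (Real.pi * w)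
    rw [mul_zero, add_zero] at this
    exact this.congr fun s => (hsplit s).symm
  -- change of variables
  have hderiv : ∀ x ∈ (Set.univ : Set ℝ), HasDerivWithinAt Real.exp (Real.exp x) Set.univ x :=
    fun x _ => (Real.hasDerivAt_exp x).hasDerivWithinAt
  have himg : Real.exp '' Set.univ = Set.Ioi 0 := by rw [Set.image_univ, Real.range_exp]
  have hfun : (fun s : ℝ => |Real.exp s| • ((fun x : ℝ => (W x - W (-x)) / (x : ℂ) ^ (2 * m + 1))
      (Real.exp s))) = fun s : ℝ => G s - G (s + Real.pi * I) := by
    ext s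
    rw [hGpi]
    simp only [hG, Real.abs_exp, real_smul, ofReal_exp]
    have h0 := exp_ne_zero (s : ℂ)
    rw [pow_succ]
    field_simp
  have hI := (integrableOn_image_iff_integrableOn_abs_deriv_smul MeasurableSet.univ hderiv
    Real.exp_injective.injOn (fun x : ℝ => (W x - W (-x)) / (x : ℂ) ^ (2 * m + 1))).1
    (by rw [himg]; exact hint)
  have hE := integral_image_eq_integral_abs_deriv_smul MeasurableSet.univ hderiv
    Real.exp_injective.injOn (fun x : ℝ => (W x - W (-x)) / (x : ℂ) ^ (2 * m + 1))
  rw [himg] at hE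
  rw [hE]
  rw [hfun] at hI ⊢
  rw [integrableOn_univ] at hI
  rw [setIntegral_univ]
  have hlim := intervalIntegral_tendsto_integral hI tendsto_neg_atTop_atBot tendsto_id
  have hlim2 : Tendsto (fun T : ℝ => ∫ s in (-T)..T, (G s - G (s + Real.pi * I))) atTop
      (nhds (I * (Real.pi * w - 0))) := by
    simp only [step1]
    exact ((step3.comp tendsto_neg_atTop_atBot).sub step2).const_mul I
  rw [tendsto_nhds_unique hlim hlim2]
  ring

/-- Positive frequency part of `sin (lam z) ^ (2m+1)`. -/
noncomputable def Epos (m : ℕ) (lam : ℝ) (z : ℂ) : ℂ :=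
  ∑ k ∈ Finset.range (m + 1), ((-Complex.I / 2) ^ (2 * m + 1) * ((-1) ^ k * ((2 * m + 1).choose k : ℂ))) *
    Complex.exp ((Complex.I * (2 * (m : ℂ) - 2 * (k : ℂ) + 1) * lam) * z)

open Complex in
lemma Epos_sub (m : ℕ) (lam : ℝ) (z : ℂ) :
    Epos m lam z - Epos m lam (-z) = sin (lam * z) ^ (2 * m + 1) := by
  have hs : sin (lam * z) = (-I / 2) * (-exp (-(I * lam * z)) + exp (I * lam * z)) := by
    have h := two_sin (lam * z)
    have e1 : -(lam * z) * I = -(I * lam * z) := by ring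
    have e2 : (lam * z) * I = I * lam * z := by ring
    rw [e1, e2] at h
    linear_combination (1 / 2) * h
  rw [hs, mul_pow, add_pow, show 2 * m + 1 + 1 = (m + 1) + (m + 1) by ring, Finset.sum_range_add,
    ← Finset.sum_range_reflect (fun x => (-exp (-(I * lam * z))) ^ (m + 1 + x) * _ * _), mul_add,
    Epos, Epos, sub_eq_add_neg, ← Finset.sum_neg_distrib, Finset.mul_sum, Finset.mul_sum]
  congr 1
  · refine Finset.sum_congr rfl fun k hk => ?_
    have hk' : k ≤ m := by simpa [Nat.lt_succ_iff] using hk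
    rw [neg_pow (exp _), ← exp_nat_mul, ← exp_nat_mul, mul_assoc ((-1) ^ k), ← exp_add]
    have : (k : ℂ) * -(I * lam * z) + ((2 * m + 1 - k : ℕ) : ℂ) * (I * lam * z)
        = (I * (2 * (m : ℂ) - 2 * (k : ℂ) + 1) * lam) * z := by
      rw [Nat.cast_sub (by omega)]; push_cast; ring
    rw [this]; ring
  · refine Finset.sum_congr rfl fun k hk => ?_
    have hk' : k ≤ m := by simpa [Nat.lt_succ_iff] using hk
    have e1 : m + 1 + (m + 1 - 1 - k) = 2 * m + 1 - k := by omega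
    have e2 : 2 * m + 1 - (2 * m + 1 - k) = k := by omega
    rw [e1, e2, Nat.choose_symm (by omega : k ≤ 2 * m + 1), neg_pow (exp _), ← exp_nat_mul, ← exp_nat_mul,
      mul_assoc ((-1) ^ _), ← exp_add]
    have : ((2 * m + 1 - k : ℕ) : ℂ) * -(I * lam * z) + (k : ℂ) * (I * lam * z)
        = (I * (2 * (m : ℂ) - 2 * (k : ℂ) + 1) * lam) * (-z) := by
      rw [Nat.cast_sub (by omega)]; push_cast; ring
    have hp : (-1 : ℂ) ^ (2 * m + 1 - k) = - (-1) ^ k := by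
      have h1 : (-1 : ℂ) ^ (2 * m + 1 - k) * (-1) ^ k = -1 := by
        rw [← pow_add, Nat.sub_add_cancel (by omega)]
        exact Odd.neg_one_pow ⟨m, rfl⟩
      have h2 : (-1 : ℂ) ^ k * (-1) ^ k = 1 := by rw [← mul_pow]; simp
      linear_combination (-1) ^ k * h1 - (-1 : ℂ) ^ (2 * m + 1 - k) * h2
    rw [this, hp]; ring

lemma Epos_diff (m : ℕ) (lam : ℝ) : Differentiable ℂ (Epos m lam) := by
  unfold Epos
  fun_prop

lemma Epos_bound (m : ℕ) (lam : ℝ) (hl : 0 < lam) : ∃ B, 0 ≤ B ∧ ∀ z : ℂ, 0 ≤ z.im →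
    ‖Epos m lam z‖ ≤ B * Real.exp (-lam * z.im) := by
  refine ⟨∑ k ∈ Finset.range (m + 1),
    ‖((-Complex.I / 2) ^ (2 * m + 1) * ((-1) ^ k * ((2 * m + 1).choose k : ℂ)))‖,
    Finset.sum_nonneg fun _ _ => norm_nonneg _, fun z hz => ?_⟩
  rw [Finset.sum_mul]
  refine (norm_sum_le _ _).trans (Finset.sum_le_sum fun k hk => ?_)
  rw [norm_mul]
  gcongr
  rw [Complex.norm_exp]
  gcongr
  have hk' : k ≤ m := by simpa [Nat.lt_succ_iff] using hk
  have e : (Complex.I * (2 * (m : ℂ) - 2 * (k : ℂ) + 1) * lam) * z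
      = ((2 * (m : ℝ) - 2 * (k : ℝ) + 1) * lam : ℝ) * (Complex.I * z) := by push_cast; ring
  rw [e, Complex.re_ofReal_mul]
  have h1 : (1 : ℝ) ≤ 2 * (m : ℝ) - 2 * (k : ℝ) + 1 := by
    have : (k : ℝ) ≤ m := by exact_mod_cast hk'
    linarith
  have h2 : 0 ≤ lam * z.im := by positivity
  simp only [Complex.mul_re, Complex.I_re, Complex.I_im]
  nlinarith

lemma Epos_deriv (m : ℕ) (lam : ℝ) (n : ℕ) : iteratedDeriv n (Epos m lam) 0 =
    ∑ k ∈ Finset.range (m + 1), ((-Complex.I / 2) ^ (2 * m + 1) * ((-1) ^ k * ((2 * m + 1).choose k : ℂ))) *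
      (Complex.I * (2 * (m : ℂ) - 2 * (k : ℂ) + 1) * lam) ^ n := by
  unfold Epos
  rw [iteratedDeriv_fun_sum (fun k _ => by fun_prop)]
  refine Finset.sum_congr rfl fun k _ => ?_
  rw [iteratedDeriv_const_mul_field, iteratedDeriv_cexp_const_mul]
  simp

lemma sum_even (a : ℕ → ℂ) (ha : ∀ i, Odd i → a i = 0) (m : ℕ) :
    ∑ i ∈ Finset.range (2 * m + 1), a i = ∑ l ∈ Finset.range (m + 1), a (2 * l) := by
  induction m with
  | zero => simp
  | succ m ih =>
    rw [show 2 * (m + 1) + 1 = 2 * m + 1 + 1 + 1 by ring, Finset.sum_range_succ,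
      Finset.sum_range_succ, ih, Finset.sum_range_succ _ (m + 1), ha (2 * m + 1) ⟨m, rfl⟩]
    simp [mul_add]

lemma coeff_eq (f : ℂ → ℂ) (hf : Differentiable ℂ f) (heven : ∀ z : ℂ, f (-z) = f z)
    (m : ℕ) (lam : ℝ) :
    Complex.I * Real.pi *
      (iteratedDeriv (2 * m) (fun z => Epos m lam z * f z) 0 / ((2 * m)! : ℂ))
      = ((-1 : ℂ) ^ m * Real.pi * ((2 * m + 1)! : ℂ) / 2 ^ (2 * m + 1)) *
        ∑ l ∈ Finset.range (m + 1),
          (((-1 : ℂ) ^ l * iteratedDeriv (2 * m - 2 * l) f 0 /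
              (((2 * l)! : ℂ) * ((2 * m - 2 * l)! : ℂ))) *
            ∑ k ∈ Finset.range (m + 1),
              (-1 : ℂ) ^ k * (2 * (m : ℂ) - 2 * (k : ℂ) + 1) ^ (2 * l) /
                ((k ! : ℂ) * ((2 * m + 1 - k)! : ℂ))) *
          (lam : ℂ) ^ (2 * l) := by
  have hfe : ∀ n, Odd n → iteratedDeriv n f 0 = 0 := by
    intro n hn
    have h := iteratedDeriv_comp_neg n f 0
    simp only [heven, neg_zero, hn.neg_one_pow, smul_eq_mul] at h
    linear_combination (1 / 2) * h
  rw [iteratedDeriv_fun_mul (Epos_diff m lam).contDiff.contDiffAt hf.contDiff.contDiffAt,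
    ]
  have hz : ∀ i ∈ Finset.range (2 * m + 1), ((2 * m).choose i : ℂ) * iteratedDeriv i (Epos m lam) 0 *
      iteratedDeriv (2 * m - i) f 0 = (fun i => if Odd i then 0 else ((2 * m).choose i : ℂ) *
      iteratedDeriv i (Epos m lam) 0 * iteratedDeriv (2 * m - i) f 0) i := by
    intro i hi
    have hi' : i ≤ 2 * m := by simpa [Nat.lt_succ_iff] using hi
    dsimp only
    split_ifs with h
    · rw [hfe (2 * m - i), mul_zero]
      exact Nat.Even.sub_odd hi' (even_two_mul m) h
    · rfl
  rw [Finset.sum_congr rfl hz, sum_even _ (fun i hi => by simp [hi]), Finset.sum_div,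
    Finset.mul_sum, Finset.mul_sum]
  refine Finset.sum_congr rfl fun l hl => ?_
  have hl' : l ≤ m := by simpa [Nat.lt_succ_iff] using hl
  have : ¬ Odd (2 * l) := by simp
  simp only [this, if_false]
  rw [Epos_deriv, Finset.mul_sum, Finset.sum_mul, Finset.sum_div, Finset.mul_sum, Finset.mul_sum,
    Finset.sum_mul, Finset.mul_sum]
  refine Finset.sum_congr rfl fun k hk => ?_
  have hk' : k ≤ m := by simpa [Nat.lt_succ_iff] using hk
  rw [Nat.cast_choose ℂ (by omega : 2 * l ≤ 2 * m), Nat.cast_choose ℂ (by omega : k ≤ 2 * m + 1)]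
  have hI : Complex.I * (-Complex.I / 2) ^ (2 * m + 1) = (-1) ^ m / 2 ^ (2 * m + 1) := by
    rw [div_pow, pow_succ, pow_mul (-Complex.I), neg_sq, Complex.I_sq]
    linear_combination (-(-1 : ℂ) ^ m / 2 ^ (2 * m + 1)) * Complex.I_sq
  have hI2 : (Complex.I * (2 * (m : ℂ) - 2 * (k : ℂ) + 1) * lam) ^ (2 * l)
      = (-1) ^ l * (2 * (m : ℂ) - 2 * (k : ℂ) + 1) ^ (2 * l) * (lam : ℂ) ^ (2 * l) := by
    rw [mul_pow, mul_pow, pow_mul Complex.I, Complex.I_sq]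
  rw [hI2]
  have n1 : ((2 * m)! : ℂ) ≠ 0 := by exact_mod_cast Nat.factorial_ne_zero _
  generalize hA : (2 * (m : ℂ) - 2 * (k : ℂ) + 1) ^ (2 * l) = A
  generalize (-Complex.I / 2) ^ (2 * m + 1) = c0 at *
  calc _ = (Complex.I * c0) * (Real.pi * (2 * m + 1)! * ((-1) ^ l * iteratedDeriv (2 * m - 2 * l) f 0 /
              (((2 * l)! : ℂ) * ((2 * m - 2 * l)! : ℂ))) * ((-1) ^ k * A / ((k ! : ℂ) * ((2 * m + 1 - k)! : ℂ))) * lam ^ (2 * l)) * (((2 * m)! : ℂ) / ((2 * m)! : ℂ)) := by ring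
    _ = _ := by rw [hI, div_self n1]; ring

/-- Theorem 2: Sinc transform with odd power `2m+1`, for `λ > τ`, equals an exact
polynomial in `λ` of degree `2m`. -/
theorem sinc_transform_odd
    (f : ℂ → ℂ) (τ : ℝ) (hτ : 0 < τ)
    (hf : Differentiable ℂ f)
    (htype : ∀ ε > 0, ∃ C > 0, ∀ z : ℂ, ‖f z‖ ≤ C * Real.exp ((τ + ε) * ‖z‖))
    (heven : ∀ z : ℂ, f (-z) = f z)
    (hint : Integrable (fun x : ℝ => f x))
    (m : ℕ) (lam : ℝ) (hlam : τ < lam) :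
    (∫ x in Set.Ioi (0 : ℝ),
        f x * (((Real.sin (lam * x)) ^ (2 * m + 1) / x ^ (2 * m + 1) : ℝ) : ℂ))
      = ((-1 : ℂ) ^ m * Real.pi * ((2 * m + 1)! : ℂ) / 2 ^ (2 * m + 1)) *
        ∑ l ∈ Finset.range (m + 1),
          (((-1 : ℂ) ^ l * iteratedDeriv (2 * m - 2 * l) f 0 /
              (((2 * l)! : ℂ) * ((2 * m - 2 * l)! : ℂ))) *
            ∑ k ∈ Finset.range (m + 1),
              (-1 : ℂ) ^ k * (2 * (m : ℂ) - 2 * (k : ℂ) + 1) ^ (2 * l) /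
                ((k ! : ℂ) * ((2 * m + 1 - k)! : ℂ))) *
          (lam : ℂ) ^ (2 * l) := by
  have hl0 : 0 < lam := hτ.trans hlam
  rw [← coeff_eq f hf heven m lam]
  set W : ℂ → ℂ := fun z => Epos m lam z * f z with hWdef
  have hWodd : ∀ z, W z - W (-z) = f z * Complex.sin (lam * z) ^ (2 * m + 1) := by
    intro z
    rw [← Epos_sub]
    simp only [hWdef, heven]
    ring
  obtain ⟨M, hM0, hM⟩ := growth f τ hτ hf htype hint ((τ + lam) / 2) (by linarith)
  obtain ⟨B, hB0, hB⟩ := Epos_bound m lam hl0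
  have hfun : ∀ x : ℝ, f x * (((Real.sin (lam * x)) ^ (2 * m + 1) / x ^ (2 * m + 1) : ℝ) : ℂ)
      = (W x - W (-x)) / (x : ℂ) ^ (2 * m + 1) := by
    intro x
    rw [hWodd]
    push_cast
    ring
  have hInt : IntegrableOn (fun x : ℝ => (W x - W (-x)) / (x : ℂ) ^ (2 * m + 1)) (Set.Ioi 0) := by
    simp only [← hfun]
    refine (Integrable.mul_bdd (c := lam ^ (2 * m + 1)) hint ?_ ?_).integrableOn
    · exact Measurable.aestronglyMeasurable (by fun_prop)
    · refine Eventually.of_forall fun x => ?_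
      rw [← div_pow, Complex.norm_real, norm_pow, norm_div, Real.norm_eq_abs, Real.norm_eq_abs]
      gcongr
      refine div_le_of_le_mul₀ (abs_nonneg _) hl0.le ?_
      refine Real.abs_sin_le_abs.trans ?_
      rw [abs_mul, abs_of_pos hl0]
  simp only [hfun]
  refine contour W ((Epos_diff m lam).mul hf) m (B * M) ((lam - τ) / 2) (by linarith) ?_ ?_ hInt
  · intro z hz
    have h1 := hB z hz
    have h2 := hM z
    rw [abs_of_nonneg hz] at h2
    simp only [hWdef, norm_mul]
    calc _ ≤ (B * Real.exp (-lam * z.im)) * (M * Real.exp ((τ + lam) / 2 * z.im)) := by gcongr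
      _ = B * M * (Real.exp (-lam * z.im) * Real.exp ((τ + lam) / 2 * z.im)) := by ring
      _ = _ := by rw [← Real.exp_add]; ring_nf
  · have hs : HasDerivAt (fun z : ℂ => Complex.sin (lam * z)) lam 0 := by
      have h1 : HasDerivAt (fun z : ℂ => (lam : ℂ) * z) lam 0 := by
        simpa using (hasDerivAt_id (0 : ℂ)).const_mul (lam : ℂ)
      simpa using h1.csin
    have h1 := hs.tendsto_slope
    have h2 : Tendsto (fun z : ℂ => f z * Complex.sin (lam * z)) (nhdsWithin 0 {0}ᶜ) (nhds 0) := by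
      have hc : Continuous fun z : ℂ => f z * Complex.sin (lam * z) :=
        hf.continuous.mul (by fun_prop)
      have := hc.tendsto 0
      simp only [mul_zero, Complex.sin_zero] at this
      exact this.mono_left nhdsWithin_le_nhds
    have h3 := h2.mul (h1.pow (2 * m))
    rw [zero_mul] at h3
    refine h3.congr fun z => ?_
    rw [hWodd, slope_def_field]
    simp only [mul_zero, Complex.sin_zero, sub_zero]
    rw [div_pow, pow_succ]
    ring
end

section
/- Let f : ℂ → ℂ be entire of exponential type τ > 0, even, with f|ℝ Lebesgue integrable. Let m ≥ 1 be an integer and let λ > τ/2 be real. Then ∫₀^∞ f(x)·sin^{2m}(λx)/x^{2m} dx = ((2m)! / (2^{2m}·(m!)²)) · FP − (π·(−1)^m·(2m)!/2^{2m}) · Σ_{l=0}^{m−1} C_{l,m} · λ^{2l+1}, where FP = lim_{ε→0⁺} [ ∫_ε^∞ f(x)/x^{2m} dx − Σ_{j=0}^{m−1} (f^{(2j)}(0)/((2j)!·(2m−2j−1))) · ε^{2j−2m+1} ] is the Hadamard finite part of the divergent integral ∫₀^∞ f(x)/x^{2m} dx, and C_{l,m} = ((−1)^l · 2^{2l+1}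 · f^{(2m−2l−2)}(0) / ((2l+1)!·(2m−2l−2)!)) · Σ_{k=0}^{m−1} (−1)^k · (m−k)^{2l+1} / (k!·(2m−k)!) (Theorem 1). -/
open MeasureTheory Filter Nat

theorem aux_growth (f : ℂ → ℂ) (τ : ℝ) 
    (hf : Differentiable ℂ f)
    (htype : ∀ ε > 0, ∃ C > 0, ∀ z : ℂ, ‖f z‖ ≤ C * Real.exp ((τ + ε) * ‖z‖))
    (heven : ∀ z : ℂ, f (-z) = f z)
    (hint : Integrable (fun x : ℝ => f x)) (hτ : 0 < τ)
    (a : ℝ) (ha : τ < a) :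
    ∃ M, ∀ z, ‖f z‖ ≤ M * Real.exp (a * |z.im|) := by
  obtain ⟨C, hC, hCf⟩ := htype ((a - τ) / 2) (by linarith)
  set b := τ + (a - τ) / 2 with hb
  have hba : b < a := by linarith
  have hb0 : 0 < b := by linarith
  obtain ⟨F, hF0, hF⟩ := hf.isExactOn_univ.with_val_at 0 0
  replace hF : ∀ z, HasDerivAt F (f z) z := fun z => hF z trivial
  have hFd : Differentiable ℂ F := fun z => (hF z).differentiableAt
  have hodd : ∀ z, F (-z) = - F z := by
    have h1 : ∀ z, HasDerivAt (fun z => F z + F (-z)) 0 z := by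
      intro z
      have h2 := (hF z).add ((hF (-z)).comp z (hasDerivAt_neg z))
      simpa [heven z] using! h2
    intro z
    have := is_const_of_deriv_eq_zero (fun z => (h1 z).differentiableAt)
      (fun z => (h1 z).deriv) z 0
    simp [hF0] at this
    linear_combination this
  have hFg : ∀ z, ‖F z‖ ≤ C * Real.exp (b * ‖z‖) * ‖z‖ := by
    intro z
    have := (convex_closedBall (0:ℂ) ‖z‖).norm_image_sub_le_of_norm_hasDerivWithin_le
      (f := F) (f' := f) (C := C * Real.exp (b * ‖z‖)) (x := 0) (y := z)
      (fun w _ => (hF w).hasDerivWithinAt) ?_ (by simp) (by simp)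
    · simpa [hF0] using this
    · intro w hw
      refine (hCf w).trans ?_
      have : ‖w‖ ≤ ‖z‖ := by simpa using hw
      gcongr
  set M0 := ∫ x : ℝ, ‖f x‖ with hM0
  have hFreal : ∀ x : ℝ, ‖F x‖ ≤ M0 := by
    intro x
    have h1 : ∫ t in (0:ℝ)..x, f t = F x - F (0:ℝ) := by
      apply intervalIntegral.integral_eq_sub_of_hasDerivAt (f := fun t : ℝ => F t)
      · intro t _
        exact (hF t).comp_ofReal
      · exact hint.intervalIntegrable
    have h2 : F x = ∫ t in (0:ℝ)..x, f t := by rw [h1]; simp [hF0]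
    rw [h2]
    refine (intervalIntegral.norm_integral_le_integral_norm_uIoc).trans ?_
    exact setIntegral_le_integral hint.norm (Eventually.of_forall fun x => norm_nonneg _)
  set M := max M0 (C / (a - b)) with hM
  set G : ℂ → ℂ := fun z => F z * Complex.exp (Complex.I * a * z) with hG
  have hGd : Differentiable ℂ G := by
    intro z; exact (hFd z).mul (by fun_prop)
  have hGn : ∀ z, ‖G z‖ = ‖F z‖ * Real.exp (- (a * z.im)) := by
    intro z; simp [hG, Complex.norm_exp]
  have hGre : ∀ x : ℝ, ‖G x‖ ≤ M := by
    intro x; rw [hGn]; simp only [Complex.ofReal_im, mul_zero, neg_zero, Real.exp_zero, mul_one]; exact (hFreal x).trans (le_max_left _ _)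
  have hGim : ∀ x : ℝ, 0 ≤ x → ‖G (x * Complex.I)‖ ≤ M := by
    intro x hx
    rw [hGn]
    refine le_trans ?_ (le_max_right _ _)
    have h1 := hFg (x * Complex.I)
    simp only [norm_mul, Complex.norm_real, Complex.norm_I, mul_one, Real.norm_eq_abs, abs_of_nonneg hx] at h1
    simp only [Complex.mul_I_im, Complex.ofReal_re]
    calc _ ≤ (C * Real.exp (b * x) * x) * Real.exp (-(a * x)) := by gcongr
      _ = C * (x * Real.exp (-((a - b) * x))) := by
        rw [show -((a - b) * x) = b * x + -(a * x) by ring, Real.exp_add]; ring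
      _ ≤ C * (1 / (a - b)) := by
        have h3 : 0 < a - b := by linarith
        gcongr
        rw [le_div_iff₀ h3, Real.exp_neg, mul_assoc, mul_comm, mul_assoc, inv_mul_le_iff₀ (Real.exp_pos _)]
        have := Real.add_one_le_exp ((a - b) * x)
        linarith
      _ = _ := by ring
  have hGO : ∀ S : Set ℂ, ∃ c < (2:ℝ), ∃ B, G =O[Bornology.cobounded ℂ ⊓ 𝓟 S] fun z => Real.exp (B * ‖z‖ ^ c) := by
    intro S
    refine ⟨1, by norm_num, b + a + 1, ?_⟩
    apply Asymptotics.IsBigO.of_bound C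
    refine Eventually.of_forall fun z => ?_
    rw [hGn]
    simp only [Real.rpow_one, Real.norm_eq_abs, Real.abs_exp]
    have h1 : -(a * z.im) ≤ a * ‖z‖ := by
      have := (abs_le.1 (Complex.abs_im_le_norm z)).1
      nlinarith
    have h2 : ‖z‖ ≤ Real.exp ‖z‖ := by linarith [Real.add_one_le_exp ‖z‖]
    calc _ ≤ (C * Real.exp (b * ‖z‖) * Real.exp ‖z‖) * Real.exp (a * ‖z‖) := by
          gcongr
          exact (hFg z).trans (by gcongr)
      _ = _ := by
        rw [show (b + a + 1) * ‖z‖ = b * ‖z‖ + ‖z‖ + a * ‖z‖ by ring, Real.exp_add, Real.exp_add]; ring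
  have hGup : ∀ z : ℂ, 0 ≤ z.im → ‖G z‖ ≤ M := by
    intro z hz
    rcases le_total 0 z.re with h | h
    · exact PhragmenLindelof.quadrant_I hGd.diffContOnCl (hGO _) (fun x _ => hGre x) hGim h hz
    · exact PhragmenLindelof.quadrant_II hGd.diffContOnCl (hGO _) (fun x _ => hGre x) hGim h hz
  have hFup : ∀ z : ℂ, 0 ≤ z.im → ‖F z‖ ≤ M * Real.exp (a * z.im) := by
    intro z hz
    have := hGup z hz
    rw [hGn, Real.exp_neg, ← div_eq_mul_inv, div_le_iff₀ (Real.exp_pos _)] at this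
    exact this
  have hFall : ∀ z : ℂ, ‖F z‖ ≤ M * Real.exp (a * |z.im|) := by
    intro z
    rcases le_total 0 z.im with h | h
    · rw [abs_of_nonneg h]; exact hFup z h
    · rw [abs_of_nonpos h]
      have := hFup (-z) (by simpa using h)
      simpa [hodd] using this
  have hMnn : 0 ≤ M := (norm_nonneg _).trans (hGre 0)
  refine ⟨M * Real.exp a, fun z => ?_⟩
  rw [← (hF z).deriv]
  have := Complex.norm_deriv_le_of_forall_mem_sphere_norm_le (c := z) (R := 1) (f := F)
    (C := M * Real.exp a * Real.exp (a * |z.im|)) one_pos hFd.diffContOnCl ?_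
  · simpa using this
  · intro w hw
    refine (hFall w).trans ?_
    rw [mul_assoc, ← Real.exp_add]
    gcongr
    have h1 : |w.im - z.im| ≤ 1 := by
      have := Complex.abs_im_le_norm (w - z)
      rw [mem_sphere_iff_norm] at hw
      simpa [hw] using this
    have h2 : |w.im| ≤ 1 + |z.im| := by
      calc |w.im| = |(w.im - z.im) + z.im| := by ring_nf
        _ ≤ _ := (abs_add_le _ _).trans (by gcongr)
    nlinarith

noncomputable def arcI (m : ℕ) (H : ℂ → ℂ) (ε : ℝ) : ℂ :=
  ∫ θ in (0:ℝ)..Real.pi, H (ε * Complex.exp (θ * Complex.I)) *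
    ((ε : ℂ) * Complex.exp (θ * Complex.I)) ^ (1 - 2 * (m : ℤ))

theorem arc_rect (m : ℕ) (h : ℂ → ℂ) (hd : Differentiable ℂ h) (ε R : ℝ) (hε : 0 < ε) (hR : ε ≤ R) :
    (∫ x in ε..R, (h x + h (-x)) / (x : ℂ) ^ (2 * m)) =
      Complex.I * arcI m h ε - Complex.I * arcI m h R := by
  have hR0 : 0 < R := hε.trans_le hR
  set Φ : ℂ → ℂ := fun w => h (Complex.exp w) * (Complex.exp w) ^ (1 - 2 * (m : ℤ)) with hΦ
  have hΦd : Differentiable ℂ Φ := by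
    intro w
    refine ((hd _).comp w (by fun_prop)).mul ?_
    exact DifferentiableAt.zpow (by fun_prop) (Or.inl (Complex.exp_ne_zero _))
  have key := Complex.integral_boundary_rect_eq_zero_of_differentiableOn Φ
    (Real.log ε : ℂ) (Real.log R + Real.pi * Complex.I) hΦd.differentiableOn
  have hside : ∀ r : ℝ, 0 < r → ∫ y in (0:ℝ)..Real.pi, Φ ((Real.log r : ℝ) + y * Complex.I) = arcI m h r := by
    intro r hr
    unfold arcI
    congr 1
    ext θ
    simp only [hΦ, Complex.exp_add, ← Complex.ofReal_exp, Real.exp_log hr]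
  simp at key
  simp only [hside ε hε, hside R hR0] at key
  set g : ℝ → ℂ := fun x => (h x + h (-x)) / (x : ℂ) ^ (2 * m) with hg
  have hc : Continuous Φ := hΦd.continuous
  rw [← intervalIntegral.integral_sub] at key
  rotate_left
  · exact (by fun_prop : Continuous fun x : ℝ => Φ x).intervalIntegrable _ _
  · exact (by fun_prop : Continuous fun x : ℝ => Φ (x + Real.pi * Complex.I)).intervalIntegrable _ _
  have hpt : ∀ t : ℝ, Φ t - Φ (t + Real.pi * Complex.I) = Real.exp t • g (Real.exp t) := by
    intro t
    have he : Complex.exp t ≠ 0 := Complex.exp_ne_zero _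
    have hz : ∀ x : ℂ, x ≠ 0 → x ^ (1 - 2 * (m : ℤ)) = x * (x ^ (2 * m))⁻¹ := by
      intro x hx
      rw [zpow_sub₀ hx, zpow_one, div_eq_mul_inv]
      norm_cast
    simp only [hΦ, hg, Complex.exp_add, Complex.exp_pi_mul_I, Complex.real_smul, Complex.ofReal_exp]
    rw [hz _ he, hz _ (by simp)]
    have : Even (2 * m) := even_two_mul m
    simp only [mul_neg, mul_one, this.neg_pow]
    ring
  simp only [hpt] at key
  have hsub := intervalIntegral.integral_deriv_smul_comp' (a := Real.log ε) (b := Real.log R)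
    (f := Real.exp) (f' := Real.exp) (g := g) (fun x _ => Real.hasDerivAt_exp x)
    Real.continuous_exp.continuousOn ?_
  · simp only [Function.comp_def, Real.exp_log hε, Real.exp_log hR0] at hsub
    rw [hsub] at key
    linear_combination key
  · rintro _ ⟨t, -, rfl⟩
    have hcc := hd.continuous
    refine ContinuousAt.continuousWithinAt ?_
    refine ContinuousAt.div ?_ ?_ ?_
    · exact Continuous.continuousAt (by fun_prop)
    · exact Continuous.continuousAt (by fun_prop)
    · exact pow_ne_zero _ (by exact_mod_cast (Real.exp_pos t).ne')

theorem norm_arg_aux (r θ : ℝ) (hr : 0 < r) : ‖(r : ℂ) * Complex.exp (θ * Complex.I)‖ = r := by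
  rw [norm_mul, Complex.norm_exp_ofReal_mul_I, mul_one, Complex.norm_real, Real.norm_of_nonneg hr.le]

theorem arc_top_tendsto (m : ℕ) (hm : 1 ≤ m) (h : ℂ → ℂ) (M : ℝ)
    (hM : ∀ z : ℂ, 0 ≤ z.im → ‖h z‖ ≤ M) :
    Tendsto (fun R : ℝ => arcI m h R) atTop (nhds 0) := by
  have hM0 : 0 ≤ M := (norm_nonneg _).trans (hM 0 (by simp))
  have hlim : Tendsto (fun R : ℝ => M * Real.pi * R⁻¹) atTop (nhds 0) := by
    simpa using tendsto_inv_atTop_zero.const_mul (M * Real.pi)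
  refine squeeze_zero_norm' ?_ hlim
  filter_upwards [eventually_ge_atTop (1:ℝ)] with R hR
  have hR0 : 0 < R := by linarith
  unfold arcI
  refine (intervalIntegral.norm_integral_le_of_norm_le_const (C := M * R⁻¹) ?_).trans ?_
  · intro θ hθ
    rw [Set.uIoc_of_le Real.pi_pos.le] at hθ
    rw [norm_mul, norm_zpow, norm_arg_aux R θ hR0]
    refine mul_le_mul (hM _ ?_) ?_ (by positivity) hM0
    · simp [Complex.exp_ofReal_mul_I_im, Complex.mul_im]
      exact mul_nonneg hR0.le (Real.sin_nonneg_of_nonneg_of_le_pi hθ.1.le hθ.2)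
    · rw [← zpow_neg_one]
      exact zpow_le_zpow_right₀ hR (by omega)
  · rw [sub_zero, abs_of_pos Real.pi_pos]; exact le_of_eq (by ring)

theorem arc_identity (m : ℕ) (hm : 1 ≤ m) (h : ℂ → ℂ) (hd : Differentiable ℂ h) (M : ℝ)
    (hM : ∀ z : ℂ, 0 ≤ z.im → ‖h z‖ ≤ M) (ε : ℝ) (hε : 0 < ε)
    (hi : IntegrableOn (fun x : ℝ => (h x + h (-x)) / (x : ℂ) ^ (2 * m)) (Set.Ioi ε)) :
    (∫ x in Set.Ioi ε, (h x + h (-x)) / (x : ℂ) ^ (2 * m)) = Complex.I * arcI m h ε := by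
  have h1 := intervalIntegral_tendsto_integral_Ioi ε hi tendsto_id
  have h2 : Tendsto (fun R : ℝ => Complex.I * arcI m h ε - Complex.I * arcI m h R) atTop
      (nhds (Complex.I * arcI m h ε - Complex.I * 0)) :=
    tendsto_const_nhds.sub ((arc_top_tendsto m hm h M hM).const_mul _)
  rw [mul_zero, sub_zero] at h2
  refine tendsto_nhds_unique h1 (h2.congr' ?_)
  filter_upwards [eventually_ge_atTop ε] with R hR
  exact (arc_rect m h hd ε R hε hR).symm

theorem arc_cont (m : ℕ) (H : ℂ → ℂ) (hH : Continuous H) (ε : ℝ) (hε : 0 < ε) :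
    Continuous (fun θ : ℝ => H (ε * Complex.exp (θ * Complex.I)) *
      ((ε : ℂ) * Complex.exp (θ * Complex.I)) ^ (1 - 2 * (m : ℤ))) := by
  refine Continuous.mul (by fun_prop) ?_
  refine Continuous.zpow₀ (by fun_prop) _ (fun θ => Or.inl ?_)
  exact mul_ne_zero (by exact_mod_cast hε.ne') (Complex.exp_ne_zero _)

theorem taylor_bound (H : ℂ → ℂ) (hH : Differentiable ℂ H) (N : ℕ) :
    ∃ C, ∀ᶠ z in nhds (0:ℂ), ‖H z - ∑ n ∈ Finset.range N, iteratedDeriv n H 0 / (n ! : ℂ) * z ^ n‖ ≤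
      C * ‖z‖ ^ N := by
  have h1 := (hH.analyticAt 0).hasFPowerSeriesAt.isBigO_sub_partialSum_pow N
  obtain ⟨C, hC⟩ := h1.bound
  refine ⟨C, hC.mono fun z hz => ?_⟩
  simpa [FormalMultilinearSeries.partialSum, FormalMultilinearSeries.ofScalars_apply_eq, mul_comm] using hz

theorem arc_taylor (m : ℕ) (H : ℂ → ℂ) (hH : Differentiable ℂ H) :
    Tendsto (fun ε : ℝ => arcI m H ε - ∑ n ∈ Finset.range (2 * m),
      iteratedDeriv n H 0 / (n ! : ℂ) * arcI m (fun z => z ^ n) ε)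
      (nhdsWithin 0 (Set.Ioi 0)) (nhds 0) := by
  obtain ⟨C, hC⟩ := taylor_bound H hH (2 * m)
  obtain ⟨δ, hδ, hCδ⟩ := Metric.eventually_nhds_iff.1 hC
  have hlim : Tendsto (fun ε : ℝ => C * Real.pi * ε) (nhdsWithin 0 (Set.Ioi 0)) (nhds 0) := by
    refine Tendsto.mono_left ?_ nhdsWithin_le_nhds
    have := (by fun_prop : Continuous fun ε : ℝ => C * Real.pi * ε).tendsto 0
    simpa using this
  refine squeeze_zero_norm' ?_ hlim
  filter_upwards [Ioo_mem_nhdsGT hδ] with ε hε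
  have hε0 : 0 < ε := hε.1
  have hsum : arcI m H ε - ∑ n ∈ Finset.range (2 * m),
      iteratedDeriv n H 0 / (n ! : ℂ) * arcI m (fun z => z ^ n) ε =
      arcI m (fun z => H z - ∑ n ∈ Finset.range (2 * m), iteratedDeriv n H 0 / (n ! : ℂ) * z ^ n) ε := by
    unfold arcI
    simp only [sub_mul, Finset.sum_mul, mul_assoc]
    rw [intervalIntegral.integral_sub, intervalIntegral.integral_finsetSum]
    · simp only [intervalIntegral.integral_const_mul]
    · intro n _
      exact ((arc_cont m (fun z => z ^ n) (by fun_prop) ε hε0).const_mul _).intervalIntegrable _ _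
    · exact (arc_cont m H hH.continuous ε hε0).intervalIntegrable _ _
    · refine Continuous.intervalIntegrable ?_ _ _
      refine continuous_finsetSum _ fun n _ => ?_
      exact ((arc_cont m (fun z => z ^ n) (by fun_prop) ε hε0).const_mul _)
  rw [hsum]
  unfold arcI
  refine (intervalIntegral.norm_integral_le_of_norm_le_const (C := C * ε) ?_).trans ?_
  · intro θ hθ
    have hn := norm_arg_aux ε θ hε0
    have hb := @hCδ ((ε : ℂ) * Complex.exp (θ * Complex.I)) (by rw [_root_.dist_zero_right, hn]; exact hε.2)
    rw [norm_mul, norm_zpow, hn]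
    rw [hn] at hb
    refine (mul_le_mul_of_nonneg_right hb (by positivity)).trans (le_of_eq ?_)
    rw [mul_assoc, ← zpow_natCast, ← zpow_add₀ hε0.ne']
    simp
  · rw [sub_zero, abs_of_pos Real.pi_pos]; exact le_of_eq (by ring)

theorem arc_pow (m n : ℕ) (ε : ℝ) (hε : 0 < ε) : arcI m (fun z => z ^ n) ε =
    (ε : ℂ) ^ ((n : ℤ) + 1 - 2 * m) * ∫ θ in (0:ℝ)..Real.pi, Complex.exp ((((n : ℤ) + 1 - 2 * m : ℤ) * Complex.I) * θ) := by
  unfold arcI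
  rw [← intervalIntegral.integral_const_mul]
  congr 1
  ext θ
  have h0 : (ε : ℂ) * Complex.exp (θ * Complex.I) ≠ 0 :=
    mul_ne_zero (by exact_mod_cast hε.ne') (Complex.exp_ne_zero _)
  beta_reduce
  rw [← zpow_natCast, ← zpow_add₀ h0, mul_zpow, ← Complex.exp_int_mul,
    show (n : ℤ) + (1 - 2 * (m:ℤ)) = (n : ℤ) + 1 - 2 * m by ring]
  congr 2
  ring

theorem arc_pow_top (m : ℕ) (hm : 1 ≤ m) (ε : ℝ) (hε : 0 < ε) :
    arcI m (fun z => z ^ (2 * (m - 1) + 1)) ε = Real.pi := by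
  rw [arc_pow _ _ _ hε, show ((2 * (m - 1) + 1 : ℕ) : ℤ) + 1 - 2 * m = 0 by omega]
  simp

theorem arc_pow_odd (m j : ℕ) (hj : j + 1 < m) (ε : ℝ) (hε : 0 < ε) :
    arcI m (fun z => z ^ (2 * j + 1)) ε = 0 := by
  rw [arc_pow _ _ _ hε, integral_exp_mul_complex]
  · have : (((((2 * j + 1 : ℕ) : ℤ) + 1 - 2 * m : ℤ) : ℂ) * Complex.I) * (Real.pi : ℂ)
      = ((j + 1 - m : ℤ) : ℂ) * (2 * Real.pi * Complex.I) := by push_cast; ring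
    rw [this, Complex.exp_int_mul_two_pi_mul_I]
    simp
  · exact mul_ne_zero (Int.cast_ne_zero.2 (by omega)) Complex.I_ne_zero

theorem arc_pow_even (m j : ℕ) (hj : j < m) (ε : ℝ) (hε : 0 < ε) :
    Complex.I * arcI m (fun z => z ^ (2 * j)) ε =
      2 * (ε : ℂ) ^ (2 * (j : ℤ) - 2 * (m : ℤ) + 1) / ((2 * m - 2 * j - 1 : ℕ) : ℂ) := by
  rw [arc_pow _ _ _ hε, integral_exp_mul_complex]
  · have : (((((2 * j : ℕ) : ℤ) + 1 - 2 * m : ℤ) : ℂ) * Complex.I) * (Real.pi : ℂ)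
      = ((j - m : ℤ) : ℂ) * (2 * Real.pi * Complex.I) + Real.pi * Complex.I := by push_cast; ring
    rw [this, Complex.exp_add, Complex.exp_int_mul_two_pi_mul_I, Complex.exp_pi_mul_I]
    have hq : (((2 * j : ℕ) : ℤ) + 1 - 2 * m : ℤ) = -((2 * m - 2 * j - 1 : ℕ) : ℤ) := by omega
    have hq2 : 2 * (j : ℤ) - 2 * (m : ℤ) + 1 = -((2 * m - 2 * j - 1 : ℕ) : ℤ) := by omega
    have h0 : ((2 * m - 2 * j - 1 : ℕ) : ℂ) ≠ 0 := by exact_mod_cast (by omega)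
    rw [hq, hq2]
    generalize (2 * m - 2 * j - 1 : ℕ) = q at *
    push_cast
    simp only [mul_zero, Complex.exp_zero]
    field_simp
    norm_num
  · exact mul_ne_zero (Int.cast_ne_zero.2 (by omega)) Complex.I_ne_zero

theorem sum_fold (m : ℕ) (F : ℕ → ℂ) :
    ∑ k ∈ Finset.range (2 * m + 1), F k = ∑ k ∈ Finset.range m, (F k + F (2 * m - k)) + F m := by
  induction m generalizing F with
  | zero => simp
  | succ m ih =>
    rw [show 2 * (m + 1) + 1 = (2 * m + 1) + 1 + 1 by ring, Finset.sum_range_succ, Finset.sum_range_succ',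
      ih (fun k => F (k + 1)), Finset.sum_range_succ']
    have : ∑ k ∈ Finset.range m, (F (k + 1) + F (2 * m - k + 1)) =
        ∑ k ∈ Finset.range m, (F (k + 1) + F (2 * (m + 1) - (k + 1))) := by
      refine Finset.sum_congr rfl fun k hk => ?_
      rw [show 2 * (m + 1) - (k + 1) = 2 * m - k + 1 by have := Finset.mem_range.1 hk; omega]
    rw [this, show 2 * (m + 1) - 0 = 2 * m + 1 + 1 by omega]
    ring

theorem sum_even_odd (m : ℕ) (F : ℕ → ℂ) :
    ∑ k ∈ Finset.range (2 * m), F k = ∑ k ∈ Finset.range m, (F (2 * k) + F (2 * k + 1)) := by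
  induction m with
  | zero => simp
  | succ m ih =>
    rw [show 2 * (m + 1) = 2 * m + 1 + 1 by ring, Finset.sum_range_succ, Finset.sum_range_succ, ih,
      Finset.sum_range_succ]
    ring

/-- coefficients -/
noncomputable def cf (m k : ℕ) : ℂ := 2 * ((-1) ^ (m + k) * ((2 * m).choose k : ℂ))

theorem cf_moment (m p : ℕ) (hp : 2 * p < 2 * m) :
    ∑ k ∈ Finset.range m, cf m k * ((m : ℂ) - k) ^ (2 * p) = - ((2 * m).choose m : ℂ) * 0 ^ p := by
  have h1 := fwdDiff_iter_eq_sum_shift (1 : ℂ) (fun r : ℂ => r ^ (2 * p)) (2 * m) (-(m : ℂ))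
  rw [fwdDiff_iter_pow_eq_zero_of_lt hp, sum_fold] at h1
  have h2 : (((-1 : ℤ) ^ (2 * m - m) * ((2 * m).choose m : ℤ)) • (-(m : ℂ) + m • (1:ℂ)) ^ (2 * p) : ℂ)
      = (-1) ^ m * ((2 * m).choose m : ℂ) * 0 ^ p := by
    rw [show 2 * m - m = m by omega]
    simp [pow_mul]
  have h3 : ∀ k ∈ Finset.range m, ((((-1 : ℤ) ^ (2 * m - k) * ((2 * m).choose k : ℤ)) • (-(m : ℂ) + k • (1:ℂ)) ^ (2 * p) : ℂ)
      + (((-1 : ℤ) ^ (2 * m - (2 * m - k)) * ((2 * m).choose (2 * m - k) : ℤ)) • (-(m : ℂ) + (2 * m - k) • (1:ℂ)) ^ (2 * p) : ℂ))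
      = (-1) ^ m * (cf m k * ((m : ℂ) - k) ^ (2 * p)) := by
    intro k hk
    have hk' := Finset.mem_range.1 hk
    have e1 : (-1 : ℂ) ^ (2 * m - k) = (-1) ^ k := by
      rw [neg_one_pow_eq_pow_mod_two, neg_one_pow_eq_pow_mod_two (n := k), show (2 * m - k) % 2 = k % 2 by omega]
    have e2 : (-1 : ℂ) ^ m * (-1) ^ m = 1 := by rw [← mul_pow]; simp
    rw [Nat.choose_symm (show k ≤ 2 * m by omega), show 2 * m - (2 * m - k) = k by omega]
    simp only [zsmul_eq_mul, nsmul_eq_mul, cf]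
    push_cast [show k ≤ 2 * m by omega]
    rw [e1, pow_mul, pow_mul, pow_mul, pow_add]
    have e3 : ((-(m : ℂ) + k * 1) ^ 2) ^ p = (((m : ℂ) - k) ^ 2) ^ p := by ring_nf
    have e4 : ((-(m : ℂ) + (2 * m - k) * 1) ^ 2) ^ p = (((m : ℂ) - k) ^ 2) ^ p := by ring_nf
    rw [e3, e4]
    linear_combination (-2 * (-1) ^ k * ((2 * m).choose k : ℂ) * (((m : ℂ) - k) ^ 2) ^ p) * e2
  rw [Finset.sum_congr rfl h3, h2, ← Finset.mul_sum] at h1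
  have e2 : (-1 : ℂ) ^ m ≠ 0 := by simp
  apply mul_left_cancel₀ e2
  simp only [Pi.zero_apply] at h1
  linear_combination -h1

theorem sin_expand (m : ℕ) (x : ℂ) :
    ∑ k ∈ Finset.range m, cf m k *
      (Complex.exp (Complex.I * (2 * ((m : ℂ) - k)) * x) + Complex.exp (-(Complex.I * (2 * ((m : ℂ) - k)) * x))) =
      2 * (2 ^ (2 * m) * Complex.sin x ^ (2 * m) - ((2 * m).choose m : ℂ)) := by
  have h0 : Complex.exp (Complex.I * x) + - Complex.exp (-(Complex.I * x)) = 2 * Complex.I * Complex.sin x := by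
    have := Complex.two_sin x
    rw [show Complex.I * x = x * Complex.I by ring, show -(x * Complex.I) = -x * Complex.I by ring]
    linear_combination (-Complex.I) * this + (Complex.exp (x * Complex.I) - Complex.exp (-x * Complex.I)) * Complex.I_sq
  have h1 := add_pow (Complex.exp (Complex.I * x)) (- Complex.exp (-(Complex.I * x))) (2 * m)
  rw [h0, sum_fold] at h1
  have e2 : (-1 : ℂ) ^ m * (-1) ^ m = 1 := by rw [← mul_pow]; simp
  have h2 : Complex.exp (Complex.I * x) ^ m * (- Complex.exp (-(Complex.I * x))) ^ (2 * m - m) = (-1) ^ m := by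
    rw [show 2 * m - m = m by omega, ← mul_pow, mul_neg, ← Complex.exp_add]
    simp
  have h3 : ∀ k ∈ Finset.range m,
      (Complex.exp (Complex.I * x) ^ k * (- Complex.exp (-(Complex.I * x))) ^ (2 * m - k) * ((2 * m).choose k : ℂ) +
      Complex.exp (Complex.I * x) ^ (2 * m - k) * (- Complex.exp (-(Complex.I * x))) ^ (2 * m - (2 * m - k)) * ((2 * m).choose (2 * m - k) : ℂ)) * 2 =
      (-1) ^ m * (cf m k *
      (Complex.exp (Complex.I * (2 * ((m : ℂ) - k)) * x) + Complex.exp (-(Complex.I * (2 * ((m : ℂ) - k)) * x)))) := by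
    intro k hk
    have hk' := Finset.mem_range.1 hk
    have e1 : (-1 : ℂ) ^ (2 * m - k) = (-1) ^ k := by
      rw [neg_one_pow_eq_pow_mod_two, neg_one_pow_eq_pow_mod_two (n := k), show (2 * m - k) % 2 = k % 2 by omega]
    rw [Nat.choose_symm (show k ≤ 2 * m by omega), show 2 * m - (2 * m - k) = k by omega]
    rw [neg_pow, neg_pow (Complex.exp (-(Complex.I * x))) k, e1]
    simp only [← Complex.exp_nat_mul, cf, pow_add]
    push_cast [show k ≤ 2 * m by omega]
    have a1 : Complex.exp (-(Complex.I * (2 * ((m : ℂ) - k)) * x)) = Complex.exp (k * (Complex.I * x)) * Complex.exp ((2 * m - k) * (-(Complex.I * x))) := by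
      rw [← Complex.exp_add]; congr 1; ring
    have a2 : Complex.exp (Complex.I * (2 * ((m : ℂ) - k)) * x) = Complex.exp ((2 * m - k) * (Complex.I * x)) * Complex.exp (k * (-(Complex.I * x))) := by
      rw [← Complex.exp_add]; congr 1; ring
    rw [a1, a2]
    generalize Complex.exp _ = u1
    generalize Complex.exp _ = u2
    generalize Complex.exp _ = u3
    generalize Complex.exp _ = u4
    linear_combination (-2 * (-1) ^ k * ((2 * m).choose k : ℂ) * (u1 * u2 + u3 * u4)) * e2
  have h4 := Finset.sum_congr rfl h3
  rw [← Finset.sum_mul, ← Finset.mul_sum] at h4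
  rw [h2] at h1
  have h5 : (2 * Complex.I * Complex.sin x) ^ (2 * m) = (-1) ^ m * (2 ^ (2 * m) * Complex.sin x ^ (2 * m)) := by
    rw [mul_pow, mul_pow, pow_mul Complex.I, Complex.I_sq]; ring
  rw [h5] at h1
  have e3 : (-1 : ℂ) ^ m ≠ 0 := by simp
  apply mul_left_cancel₀ e3
  linear_combination -h4 - 2 * h1

/-- Exponential sum. -/
noncomputable def Wf (m : ℕ) (lam : ℝ) (z : ℂ) : ℂ :=
  ∑ k ∈ Finset.range m, cf m k * Complex.exp (Complex.I * (2 * ((m : ℂ) - k)) * lam * z)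

theorem Wf_diff (m : ℕ) (lam : ℝ) : Differentiable ℂ (Wf m lam) := by
  unfold Wf
  fun_prop

theorem Wf_deriv (m p : ℕ) (lam : ℝ) : iteratedDeriv p (Wf m lam) 0 =
    ∑ k ∈ Finset.range m, cf m k * (Complex.I * (2 * ((m : ℂ) - k)) * lam) ^ p := by
  unfold Wf
  rw [iteratedDeriv_fun_sum]
  · refine Finset.sum_congr rfl fun k _ => ?_
    rw [iteratedDeriv_const_mul_field, iteratedDeriv_cexp_const_mul]
    simp
  · intro k _
    exact ContDiff.contDiffAt (by fun_prop)

theorem Wf_deriv_even (m p : ℕ) (hp : p < m) (lam : ℝ) : iteratedDeriv (2 * p) (Wf m lam) 0 =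
    - ((2 * m).choose m : ℂ) * 0 ^ p := by
  rw [Wf_deriv]
  have := cf_moment m p (by omega)
  have h : ∀ k ∈ Finset.range m, cf m k * (Complex.I * (2 * ((m : ℂ) - k)) * lam) ^ (2 * p) =
      (Complex.I * 2 * lam) ^ (2 * p) * (cf m k * ((m : ℂ) - k) ^ (2 * p)) := by
    intro k _
    simp only [mul_pow]; ring
  rw [Finset.sum_congr rfl h, ← Finset.mul_sum, this]
  rcases Nat.eq_zero_or_pos p with rfl | hp0
  · simp
  · simp [hp0.ne']

theorem even_deriv_odd (f : ℂ → ℂ) (heven : ∀ z : ℂ, f (-z) = f z) (j : ℕ) :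
    iteratedDeriv (2 * j + 1) f 0 = 0 := by
  have h := iteratedDeriv_comp_neg (2 * j + 1) f (0 : ℂ)
  simp only [heven, neg_zero, smul_eq_mul] at h
  rw [pow_succ, pow_mul] at h
  simp at h
  have h2 : (2:ℂ) * iteratedDeriv (2 * j + 1) f 0 = 0 := by linear_combination h
  simpa using h2

theorem mul_coeff (f g : ℂ → ℂ) (hf : Differentiable ℂ f) (hg : Differentiable ℂ g) (n : ℕ) :
    iteratedDeriv n (fun z => f z * g z) 0 / (n ! : ℂ) = ∑ i ∈ Finset.range (n + 1),
      (iteratedDeriv i f 0 / (i ! : ℂ)) * (iteratedDeriv (n - i) g 0 / ((n - i)! : ℂ)) := by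
  rw [iteratedDeriv_fun_mul hf.contDiff.contDiffAt hg.contDiff.contDiffAt, Finset.sum_div]
  refine Finset.sum_congr rfl fun i hi => ?_
  have hi' : i ≤ n := by have := Finset.mem_range.1 hi; omega
  rw [Nat.cast_choose ℂ hi']
  have h1 : (n ! : ℂ) ≠ 0 := by exact_mod_cast n.factorial_ne_zero
  have h2 : (i ! : ℂ) ≠ 0 := by exact_mod_cast i.factorial_ne_zero
  have h3 : ((n - i)! : ℂ) ≠ 0 := by exact_mod_cast (n - i).factorial_ne_zero
  field_simp

theorem H_even (f : ℂ → ℂ) (hf : Differentiable ℂ f) (heven : ∀ z : ℂ, f (-z) = f z)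
    (m j : ℕ) (hj : j < m) (lam : ℝ) :
    iteratedDeriv (2 * j) (fun z => f z * Wf m lam z) 0 / ((2 * j)! : ℂ) =
      - ((2 * m).choose m : ℂ) * (iteratedDeriv (2 * j) f 0 / ((2 * j)! : ℂ)) := by
  rw [mul_coeff f _ hf (Wf_diff m lam), Finset.sum_range_succ, Finset.sum_eq_zero]
  · have := Wf_deriv_even m 0 (by omega) lam
    simp at this
    simp [this]; ring
  · intro i hi
    have hi' := Finset.mem_range.1 hi
    rcases Nat.even_or_odd' i with ⟨q, rfl | rfl⟩
    · rw [← Nat.mul_sub, Wf_deriv_even m (j - q) (by omega) lam, zero_pow (by omega)]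
      simp
    · rw [even_deriv_odd f heven]; simp

theorem H_top (f : ℂ → ℂ) (hf : Differentiable ℂ f) (heven : ∀ z : ℂ, f (-z) = f z)
    (m : ℕ) (hm : 1 ≤ m) (lam : ℝ) :
    iteratedDeriv (2 * (m - 1) + 1) (fun z => f z * Wf m lam z) 0 / ((2 * (m - 1) + 1)! : ℂ) =
      ∑ l ∈ Finset.range m, (iteratedDeriv (2 * m - 2 * l - 2) f 0 / ((2 * m - 2 * l - 2)! : ℂ)) *
        (iteratedDeriv (2 * l + 1) (Wf m lam) 0 / ((2 * l + 1)! : ℂ)) := by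
  rw [mul_coeff f _ hf (Wf_diff m lam), show 2 * (m - 1) + 1 + 1 = 2 * m by omega, sum_even_odd,
    ← Finset.sum_range_reflect]
  refine Finset.sum_congr rfl fun l hl => ?_
  have hl' := Finset.mem_range.1 hl
  rw [even_deriv_odd f heven, show 2 * (m - 1 - l) = 2 * m - 2 * l - 2 by omega,
    show 2 * (m - 1) + 1 - (2 * m - 2 * l - 2) = 2 * l + 1 by omega]
  simp

theorem H_bound (f : ℂ → ℂ) (m : ℕ) (lam M : ℝ) (hlam : 0 < lam)
    (hM : ∀ z, ‖f z‖ ≤ M * Real.exp (2 * lam * |z.im|)) :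
    ∀ z : ℂ, 0 ≤ z.im → ‖f z * Wf m lam z‖ ≤ ∑ k ∈ Finset.range m, ‖cf m k‖ * M := by
  intro z hz
  unfold Wf
  rw [Finset.mul_sum]
  refine (norm_sum_le _ _).trans (Finset.sum_le_sum fun k hk => ?_)
  have hk' : (k : ℝ) + 1 ≤ m := by exact_mod_cast Finset.mem_range.1 hk
  have hM0 : 0 ≤ M := by simpa using (norm_nonneg _).trans (hM 0)
  have h1 := hM z
  rw [abs_of_nonneg hz] at h1
  have h2 : ‖Complex.exp (Complex.I * (2 * ((m : ℂ) - k)) * lam * z)‖ ≤ Real.exp (-(2 * lam * z.im)) := by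
    rw [Complex.norm_exp]
    gcongr
    have : (Complex.I * (2 * ((m : ℂ) - k)) * lam * z).re = -(2 * ((m:ℝ) - k) * lam * z.im) := by
      rw [show (Complex.I * (2 * ((m : ℂ) - k)) * lam * z) = ((2 * ((m:ℝ) - k) * lam : ℝ) : ℂ) * (Complex.I * z) by
        push_cast; ring]
      rw [Complex.re_ofReal_mul]
      simp
    rw [this]
    have h3 : 0 ≤ lam * z.im := by positivity
    nlinarith
  rw [norm_mul, norm_mul]
  calc _ ≤ (M * Real.exp (2 * lam * z.im)) * (‖cf m k‖ * Real.exp (-(2 * lam * z.im))) := by gcongr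
    _ = ‖cf m k‖ * M * (Real.exp (2 * lam * z.im) * Real.exp (-(2 * lam * z.im))) := by ring
    _ = _ := by rw [← Real.exp_add]; simp

theorem H_sym (f : ℂ → ℂ) (heven : ∀ z : ℂ, f (-z) = f z) (m : ℕ) (lam : ℝ) (x : ℝ) :
    (f x * Wf m lam x + f (-x) * Wf m lam (-x)) / (x : ℂ) ^ (2 * m) =
      2 * 2 ^ (2 * m) * (f x * (((Real.sin (lam * x)) ^ (2 * m) / x ^ (2 * m) : ℝ) : ℂ)) -
        2 * ((2 * m).choose m : ℂ) * (f x / (x : ℂ) ^ (2 * m)) := by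
  have h1 := sin_expand m (lam * x)
  have h2 : Wf m lam x + Wf m lam (-x) = ∑ k ∈ Finset.range m, cf m k *
      (Complex.exp (Complex.I * (2 * ((m : ℂ) - k)) * (lam * x)) + Complex.exp (-(Complex.I * (2 * ((m : ℂ) - k)) * (lam * x)))) := by
    unfold Wf
    rw [← Finset.sum_add_distrib]
    refine Finset.sum_congr rfl fun k _ => ?_
    rw [← mul_add]
    ring_nf
  rw [heven, ← mul_add, h2, h1]
  push_cast
  ring

theorem int_tail (f : ℂ → ℂ) (hint : Integrable (fun x : ℝ => f x)) (m : ℕ) (ε : ℝ) (hε : 0 < ε) :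
    IntegrableOn (fun x : ℝ => f x / (x : ℂ) ^ (2 * m)) (Set.Ioi ε) := by
  have h1 : IntegrableOn (fun x : ℝ => f x) (Set.Ioi ε) := hint.integrableOn
  have : IntegrableOn (fun x : ℝ => ((x : ℂ) ^ (2 * m))⁻¹ * f x) (Set.Ioi ε) := by
    refine Integrable.bdd_mul (c := (ε ^ (2 * m))⁻¹) h1 ?_ ?_
    · exact (by fun_prop : Measurable fun x : ℝ => ((x : ℂ) ^ (2 * m))⁻¹).aestronglyMeasurable
    · refine (ae_restrict_iff' measurableSet_Ioi).2 (Eventually.of_forall fun x hx => ?_)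
      have hx' : ε < x := hx
      rw [norm_inv, norm_pow, Complex.norm_real, Real.norm_of_nonneg (hε.trans hx').le]
      gcongr
  refine this.congr (Eventually.of_forall fun x => ?_)
  simp only [div_eq_mul_inv]; ring

theorem int_sinc (f : ℂ → ℂ) (hint : Integrable (fun x : ℝ => f x)) (m : ℕ) (lam : ℝ) :
    Integrable (fun x : ℝ => f x * (((Real.sin (lam * x)) ^ (2 * m) / x ^ (2 * m) : ℝ) : ℂ)) := by
  refine Integrable.mul_bdd (c := |lam| ^ (2 * m)) hint ?_ ?_
  · exact (by fun_prop : Measurable fun x : ℝ => (((Real.sin (lam * x)) ^ (2 * m) / x ^ (2 * m) : ℝ) : ℂ)).aestronglyMeasurable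
  · refine Eventually.of_forall fun x => ?_
    rw [Complex.norm_real, ← div_pow, norm_pow]
    gcongr
    rw [norm_div, Real.norm_eq_abs, Real.norm_eq_abs]
    refine div_le_of_le_mul₀ (abs_nonneg _) (abs_nonneg _) ?_
    rw [← abs_mul]
    exact Real.abs_sin_le_abs

theorem tail_tendsto (g : ℝ → ℂ) (hg : Integrable g) :
    Tendsto (fun ε : ℝ => ∫ x in Set.Ioi ε, g x) (nhdsWithin 0 (Set.Ioi 0)) (nhds (∫ x in Set.Ioi 0, g x)) := by
  have h1 : ∀ ε : ℝ, ∫ x in Set.Ioi ε, g x = (∫ x in Set.Ioi 0, g x) - ∫ x in (0:ℝ)..ε, g x := by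
    intro ε
    rw [← intervalIntegral.integral_Ioi_sub_Ioi' hg.integrableOn hg.integrableOn]
    ring
  refine Tendsto.congr (fun ε => (h1 ε).symm) ?_
  have h2 : Continuous fun ε : ℝ => ∫ x in (0:ℝ)..ε, g x :=
    intervalIntegral.continuous_primitive (fun a b => hg.intervalIntegrable) 0
  have h3 := (h2.tendsto 0).const_sub (∫ x in Set.Ioi 0, g x)
  simp only [intervalIntegral.integral_same, sub_zero] at h3
  exact h3.mono_left nhdsWithin_le_nhds

theorem arc_asymp (f : ℂ → ℂ) (hf : Differentiable ℂ f) (heven : ∀ z : ℂ, f (-z) = f z)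
    (m : ℕ) (hm : 1 ≤ m) (lam : ℝ) (ε : ℝ) (hε : 0 < ε) :
    Complex.I * ∑ n ∈ Finset.range (2 * m),
      iteratedDeriv n (fun z => f z * Wf m lam z) 0 / (n ! : ℂ) * arcI m (fun z => z ^ n) ε =
    Complex.I * Real.pi * (iteratedDeriv (2 * (m - 1) + 1) (fun z => f z * Wf m lam z) 0 / ((2 * (m - 1) + 1)! : ℂ))
    - 2 * ((2 * m).choose m : ℂ) * ∑ j ∈ Finset.range m,
              (iteratedDeriv (2 * j) f 0 /
                  (((2 * j)! : ℂ) * ((2 * m - 2 * j - 1 : ℕ) : ℂ))) *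
                ((ε : ℂ) ^ (2 * (j : ℤ) - 2 * (m : ℤ) + 1)) := by
  rw [sum_even_odd, Finset.sum_add_distrib]
  have h1 : ∑ k ∈ Finset.range m, iteratedDeriv (2 * k + 1) (fun z => f z * Wf m lam z) 0 / ((2 * k + 1)! : ℂ)
      * arcI m (fun z => z ^ (2 * k + 1)) ε =
      (iteratedDeriv (2 * (m - 1) + 1) (fun z => f z * Wf m lam z) 0 / ((2 * (m - 1) + 1)! : ℂ)) * Real.pi := by
    rw [Finset.sum_eq_single (m - 1), arc_pow_top m hm ε hε]
    · intro k hk hk2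
      have := Finset.mem_range.1 hk
      rw [arc_pow_odd m k (by omega) ε hε, mul_zero]
    · intro h
      exact absurd (Finset.mem_range.2 (by omega)) h
  rw [h1, mul_add, Finset.mul_sum]
  have h2 : ∀ k ∈ Finset.range m, Complex.I * (iteratedDeriv (2 * k) (fun z => f z * Wf m lam z) 0 / ((2 * k)! : ℂ)
      * arcI m (fun z => z ^ (2 * k)) ε) = -(2 * ((2 * m).choose m : ℂ)) * ((iteratedDeriv (2 * k) f 0 /
                  (((2 * k)! : ℂ) * ((2 * m - 2 * k - 1 : ℕ) : ℂ))) *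
                ((ε : ℂ) ^ (2 * (k : ℤ) - 2 * (m : ℤ) + 1))) := by
    intro k hk
    have hk' := Finset.mem_range.1 hk
    rw [mul_left_comm, arc_pow_even m k hk' ε hε, H_even f hf heven m k hk' lam]
    have h0 : ((2 * m - 2 * k - 1 : ℕ) : ℂ) ≠ 0 := by exact_mod_cast (by omega)
    have h1 : ((2 * k)! : ℂ) ≠ 0 := by exact_mod_cast (2 * k).factorial_ne_zero
    field_simp
  rw [Finset.sum_congr rfl h2, ← Finset.mul_sum]
  ring

theorem final_alg (f : ℂ → ℂ) (hf : Differentiable ℂ f) (heven : ∀ z : ℂ, f (-z) = f z)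
    (m : ℕ) (hm : 1 ≤ m) (lam : ℝ) :
    Complex.I * Real.pi * (iteratedDeriv (2 * (m - 1) + 1) (fun z => f z * Wf m lam z) 0 / ((2 * (m - 1) + 1)! : ℂ))
      = - 2 * ((Real.pi : ℂ) * (-1 : ℂ) ^ m * ((2 * m)! : ℂ)) *
            ∑ l ∈ Finset.range m,
              (((-1 : ℂ) ^ l * 2 ^ (2 * l + 1) * iteratedDeriv (2 * m - 2 * l - 2) f 0 /
                  (((2 * l + 1)! : ℂ) * ((2 * m - 2 * l - 2)! : ℂ))) *
                ∑ k ∈ Finset.range m,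
                  (-1 : ℂ) ^ k * ((m : ℂ) - (k : ℂ)) ^ (2 * l + 1) /
                    ((k ! : ℂ) * ((2 * m - k)! : ℂ))) *
              (lam : ℂ) ^ (2 * l + 1) := by
  rw [H_top f hf heven m hm lam, Finset.mul_sum, Finset.mul_sum]
  refine Finset.sum_congr rfl fun l hl => ?_
  have h1 : Complex.I * iteratedDeriv (2 * l + 1) (Wf m lam) 0 =
      -2 * (-1 : ℂ) ^ m * ((2 * m)! : ℂ) * (-1) ^ l * 2 ^ (2 * l + 1) * (lam : ℂ) ^ (2 * l + 1) * ∑ k ∈ Finset.range m,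
                  (-1 : ℂ) ^ k * ((m : ℂ) - (k : ℂ)) ^ (2 * l + 1) /
                    ((k ! : ℂ) * ((2 * m - k)! : ℂ)) := by
    rw [Wf_deriv, Finset.mul_sum, Finset.mul_sum]
    refine Finset.sum_congr rfl fun k hk => ?_
    have hk' := Finset.mem_range.1 hk
    have hI : Complex.I * Complex.I ^ (2 * l + 1) = - (-1) ^ l := by
      rw [← _root_.pow_succ', show 2 * l + 1 + 1 = 2 * (l + 1) by ring, pow_mul, Complex.I_sq]; ring
    unfold cf
    rw [Nat.cast_choose ℂ (show k ≤ 2 * m by omega)]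
    simp only [mul_pow, pow_add (-1 : ℂ) m k]
    linear_combination (2 * ((-1) ^ m * (-1) ^ k * (((2 * m)! : ℂ) / ((k ! : ℂ) * ((2 * m - k)! : ℂ)))) *
      (2 ^ (2 * l + 1) * ((m : ℂ) - k) ^ (2 * l + 1)) * (lam : ℂ) ^ (2 * l + 1)) * hI
  have h2 : ((2 * l + 1)! : ℂ) ≠ 0 := by exact_mod_cast (2 * l + 1).factorial_ne_zero
  have h3 : ((2 * m - 2 * l - 2)! : ℂ) ≠ 0 := by exact_mod_cast (2 * m - 2 * l - 2).factorial_ne_zero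
  linear_combination (Real.pi * (iteratedDeriv (2 * m - 2 * l - 2) f 0 / ((2 * m - 2 * l - 2)! : ℂ)) / ((2 * l + 1)! : ℂ)) * h1


/-- Theorem 1: Sinc transform with even power `2m`, for `λ > τ/2`, equals the Hadamard
finite part of `∫₀^∞ f(x)/x^{2m} dx` times `(2m)!/(2^{2m} (m!)²)` minus an exact odd
polynomial in `λ` of degree `2m-1`. -/
theorem sinc_transform_even
    (f : ℂ → ℂ) (τ : ℝ) (hτ : 0 < τ)
    (hf : Differentiable ℂ f)
    (htype : ∀ ε > 0, ∃ C > 0, ∀ z : ℂ, ‖f z‖ ≤ C * Real.exp ((τ + ε) * ‖z‖))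
    (heven : ∀ z : ℂ, f (-z) = f z)
    (hint : Integrable (fun x : ℝ => f x))
    (m : ℕ) (hm : 1 ≤ m) (lam : ℝ) (hlam : τ / 2 < lam) :
    ∃ FP : ℂ,
      Tendsto
        (fun ε : ℝ =>
          (∫ x in Set.Ioi ε, f x / (x : ℂ) ^ (2 * m)) -
            ∑ j ∈ Finset.range m,
              (iteratedDeriv (2 * j) f 0 /
                  (((2 * j)! : ℂ) * ((2 * m - 2 * j - 1 : ℕ) : ℂ))) *
                ((ε : ℂ) ^ (2 * (j : ℤ) - 2 * (m : ℤ) + 1)))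
        (nhdsWithin 0 (Set.Ioi 0)) (nhds FP) ∧
      (∫ x in Set.Ioi (0 : ℝ),
          f x * (((Real.sin (lam * x)) ^ (2 * m) / x ^ (2 * m) : ℝ) : ℂ))
        = (((2 * m)! : ℂ) / (2 ^ (2 * m) * ((m ! : ℂ)) ^ 2)) * FP -
          ((Real.pi : ℂ) * (-1 : ℂ) ^ m * ((2 * m)! : ℂ) / 2 ^ (2 * m)) *
            ∑ l ∈ Finset.range m,
              (((-1 : ℂ) ^ l * 2 ^ (2 * l + 1) * iteratedDeriv (2 * m - 2 * l - 2) f 0 /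
                  (((2 * l + 1)! : ℂ) * ((2 * m - 2 * l - 2)! : ℂ))) *
                ∑ k ∈ Finset.range m,
                  (-1 : ℂ) ^ k * ((m : ℂ) - (k : ℂ)) ^ (2 * l + 1) /
                    ((k ! : ℂ) * ((2 * m - k)! : ℂ))) *
              (lam : ℂ) ^ (2 * l + 1) := by
  have hlam0 : 0 < lam := by linarith
  obtain ⟨M, hM⟩ := aux_growth f τ hf htype heven hint hτ (2 * lam) (by linarith)
  set H : ℂ → ℂ := fun z => f z * Wf m lam z with hH
  have hHd : Differentiable ℂ H := hf.mul (Wf_diff m lam)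
  set K : ℂ := ((2 * m).choose m : ℂ) with hK
  have hK0 : K ≠ 0 := by
    rw [hK]; exact_mod_cast (Nat.choose_pos (by omega)).ne'
  set T : ℂ := Complex.I * Real.pi * (iteratedDeriv (2 * (m - 1) + 1) H 0 / ((2 * (m - 1) + 1)! : ℂ)) with hT
  set g : ℝ → ℂ := fun x => f x * (((Real.sin (lam * x)) ^ (2 * m) / x ^ (2 * m) : ℝ) : ℂ) with hg
  have hgi : Integrable g := int_sinc f hint m lam
  refine ⟨(2 * 2 ^ (2 * m) * (∫ x in Set.Ioi 0, g x) - T) / (2 * K), ?_, ?_⟩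
  · have h1 := tail_tendsto g hgi
    have h2 := (arc_taylor m H hHd).const_mul Complex.I
    have h3 := (((h1.const_mul (2 * 2 ^ (2 * m))).sub h2).sub_const T).div_const (2 * K)
    rw [mul_zero, sub_zero] at h3
    refine h3.congr' ?_
    filter_upwards [self_mem_nhdsWithin] with ε hε
    have hε0 : 0 < ε := hε
    have hi := int_tail f hint m ε hε0
    have hfun : (fun x : ℝ => (H x + H (-x)) / (x : ℂ) ^ (2 * m)) =
        fun x : ℝ => 2 * 2 ^ (2 * m) * g x - 2 * K * (f x / (x : ℂ) ^ (2 * m)) := by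
      funext x
      exact H_sym f heven m lam x
    have hA := arc_identity m hm H hHd _ (H_bound f m lam M hlam0 hM) ε hε0 (by
      rw [hfun]
      exact (hgi.integrableOn.const_mul _).sub (hi.const_mul _))
    rw [hfun, integral_sub (hgi.integrableOn.const_mul _) (hi.const_mul _), integral_const_mul,
      integral_const_mul] at hA
    have hB := arc_asymp f hf heven m hm lam ε hε0
    rw [div_eq_iff (by simpa using hK0)]
    linear_combination hA + hB
  · have hF := final_alg f hf heven m hm lam
    have hC : K = ((2 * m)! : ℂ) / (m ! : ℂ) ^ 2 := by
      rw [hK, Nat.cast_choose ℂ (show m ≤ 2 * m by omega), show 2 * m - m = m by omega, sq]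
    have hcoef : (((2 * m)! : ℂ) / (2 ^ (2 * m) * ((m ! : ℂ)) ^ 2)) = K / 2 ^ (2 * m) := by
      rw [hC, div_div]; congr 1; exact mul_comm _ _
    rw [hcoef]
    have h2 : (2 : ℂ) ^ (2 * m) ≠ 0 := by simp
    have h3 : K / 2 ^ (2 * m) * ((2 * 2 ^ (2 * m) * (∫ x in Set.Ioi 0, g x) - T) / (2 * K)) =
        (∫ x in Set.Ioi 0, g x) - T / (2 * 2 ^ (2 * m)) := by
      field_simp
    rw [h3, hT, hF]
    generalize Finset.sum (Finset.range m) (M := ℂ) _ = S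
    field_simp
    ring
end

section
/- Let f : ℂ → ℂ be entire of exponential type τ > 0, even, with f|ℝ Lebesgue integrable. Let m ≥ 1 be an integer and let λ₁, λ₂ be reals with λ₁ > τ/2 and λ₂ > τ/2. Then ∫₀^∞ f(x)·(sin^{2m}(λ₁x) − sin^{2m}(λ₂x))/x^{2m} dx = −(π·(−1)^m·(2m)!/2^{2m}) · Σ_{l=0}^{m−1} C_{l,m} · (λ₁^{2l+1} − λ₂^{2l+1}), where C_{l,m} = ((−1)^l · 2^{2l+1} · f^{(2m−2l−2)}(0) / ((2l+1)!·(2m−2l−2)!)) · Σ_{k=0}^{m−1} (−1)^k · (m−k)^{2l+1} / (k!·(2m−k)!). (Difference form of Theorem 1, in which the λ-independent finite-part term cancels.) -/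
open MeasureTheory Filter Nat

lemma aux_bound (f : ℂ → ℂ) (τ b : ℝ) (hτ : 0 < τ) (hb : τ < b)
    (hf : Differentiable ℂ f)
    (htype : ∀ ε > 0, ∃ C > 0, ∀ z : ℂ, ‖f z‖ ≤ C * Real.exp ((τ + ε) * ‖z‖))
    (heven : ∀ z : ℂ, f (-z) = f z)
    (hint : Integrable (fun x : ℝ => f x)) :
    ∃ M : ℝ, ∀ z : ℂ, ‖f z‖ ≤ M * Real.exp (b * |z.im|) := by
  obtain ⟨F, hF0, hF⟩ := (hf.isExactOn_univ).with_val_at 0 0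
  replace hF : ∀ z, HasDerivAt F (f z) z := fun z => hF z trivial
  have hFd : Differentiable ℂ F := fun z => (hF z).differentiableAt
  have hFodd : ∀ z, F (-z) = - F z := by
    intro z
    have h1 : ∀ z, HasDerivAt (fun z => F (-z) + F z) 0 z := by
      intro z
      have h2 := ((hF (-z)).comp z (hasDerivAt_neg z)).add (hF z)
      simp only [heven] at h2
      have h3 : f z * -1 + f z = 0 := by ring
      rw [h3] at h2
      exact h2
    have := is_const_of_deriv_eq_zero (f := fun z => F (-z) + F z)
      (fun z => (h1 z).differentiableAt) (fun z => (h1 z).deriv) z 0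
    simp [hF0] at this
    linear_combination this
  set M := ∫ x : ℝ, ‖f x‖ with hM
  have hFreal : ∀ x : ℝ, ‖F x‖ ≤ M := by
    intro x
    have h1 : ∫ t in (0:ℝ)..x, f t = F x - F (0:ℝ) := by
      apply intervalIntegral.integral_eq_sub_of_hasDerivAt
      · intro t _
        exact (hF t).comp_ofReal
      · exact hint.intervalIntegrable
    simp only [Complex.ofReal_zero, hF0, sub_zero] at h1
    rw [← h1]
    refine (intervalIntegral.norm_integral_le_integral_norm_uIoc).trans ?_
    exact setIntegral_le_integral hint.norm (Eventually.of_forall fun _ => norm_nonneg _)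
  have hM0 : 0 ≤ M := (norm_nonneg _).trans (hFreal 0)
  -- growth of F
  have hgrow : ∃ C > 0, ∀ z, ‖F z‖ ≤ C * Real.exp (b * ‖z‖) := by
    set ε := (b - τ) / 2 with hε
    have hε0 : 0 < ε := by rw [hε]; linarith
    obtain ⟨C, hC, h⟩ := htype ε hε0
    refine ⟨C / ε, by positivity, fun z => ?_⟩
    have h1 : ‖F z - F 0‖ ≤ (C * Real.exp ((τ + ε) * ‖z‖)) * ‖z - 0‖ := by
      apply Convex.norm_image_sub_le_of_norm_hasDerivWithin_le (f' := f)
        (s := Metric.closedBall (0:ℂ) ‖z‖)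
      · intro x _
        exact (hF x).hasDerivWithinAt
      · intro x hx
        refine (h x).trans ?_
        have : ‖x‖ ≤ ‖z‖ := by simpa using hx
        gcongr
      · exact convex_closedBall _ _
      · simp
      · simp
    rw [hF0, sub_zero, sub_zero] at h1
    refine h1.trans ?_
    have h2 : ε * ‖z‖ ≤ Real.exp (ε * ‖z‖) := by
      linarith [Real.add_one_le_exp (ε * ‖z‖)]
    have h3 : b * ‖z‖ = (τ + ε) * ‖z‖ + ε * ‖z‖ := by rw [hε]; ring
    rw [h3, Real.exp_add]
    calc _ = C / ε * (Real.exp ((τ + ε) * ‖z‖) * (ε * ‖z‖)) := by field_simp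
      _ ≤ _ := by gcongr
  obtain ⟨C, hC, hgrow⟩ := hgrow
  have hb0 : 0 < b := hτ.trans hb
  have hPL : ∀ w : ℂ, 0 ≤ w.re → ‖F (Complex.I * w) * Complex.exp (-b * w)‖ ≤ M := by
    intro w hw
    refine PhragmenLindelof.right_half_plane_of_bounded_on_real
      (f := fun w => F (Complex.I * w) * Complex.exp (-b * w)) ?_ ?_ ?_ ?_ hw
    · apply Differentiable.diffContOnCl
      exact (hFd.comp (differentiable_id.const_mul _)).mul (by fun_prop)
    · refine ⟨1, by norm_num, 2 * b, ?_⟩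
      refine Asymptotics.IsBigO.of_bound C (Eventually.of_forall fun w => ?_)
      rw [norm_mul, Complex.norm_exp, Real.norm_eq_abs, Real.abs_exp, Real.rpow_one]
      have h1 := hgrow (Complex.I * w)
      rw [norm_mul, Complex.norm_I, one_mul] at h1
      have h2 : (-b * w : ℂ).re ≤ b * ‖w‖ := by
        have := (abs_le.1 (Complex.abs_re_le_norm w)).1
        simp
        nlinarith
      calc _ ≤ C * Real.exp (b * ‖w‖) * Real.exp (b * ‖w‖) := by gcongr
        _ = _ := by rw [mul_assoc, ← Real.exp_add]; ring_nf
    · refine isBoundedUnder_of_eventually_le (a := C) ?_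
      filter_upwards [eventually_ge_atTop 0] with x hx
      rw [norm_mul, Complex.norm_exp]
      have h1 := hgrow (Complex.I * x)
      rw [norm_mul, Complex.norm_I, one_mul, Complex.norm_real, Real.norm_of_nonneg hx] at h1
      calc _ ≤ C * Real.exp (b * x) * Real.exp (-b * x : ℂ).re := by gcongr
        _ = C := by rw [mul_assoc, ← Real.exp_add]; simp
    · intro x
      rw [norm_mul, Complex.norm_exp]
      have : Complex.I * (x * Complex.I) = ((-x : ℝ) : ℂ) := by
        push_cast; linear_combination (x:ℂ) * Complex.I_sq
      rw [this]
      simpa using hFreal (-x)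
  have hFup : ∀ z : ℂ, 0 ≤ z.im → ‖F z‖ ≤ M * Real.exp (b * z.im) := by
    intro z hz
    have h1 := hPL (-Complex.I * z) (by simpa using hz)
    have h2 : Complex.I * (-Complex.I * z) = z := by linear_combination -z * Complex.I_sq
    rw [h2, norm_mul, Complex.norm_exp] at h1
    have h3 : (-b * (-Complex.I * z) : ℂ).re = -(b * z.im) := by simp
    rw [h3, Real.exp_neg] at h1
    rwa [← div_eq_mul_inv, div_le_iff₀ (Real.exp_pos _)] at h1
  have hFall : ∀ z : ℂ, ‖F z‖ ≤ M * Real.exp (b * |z.im|) := by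
    intro z
    rcases le_total 0 z.im with h | h
    · rw [abs_of_nonneg h]; exact hFup z h
    · rw [abs_of_nonpos h]
      have := hFup (-z) (by simpa using h)
      rwa [hFodd, norm_neg, Complex.neg_im] at this
  refine ⟨M * Real.exp b, fun z => ?_⟩
  rw [← (hF z).deriv]
  have := Complex.norm_deriv_le_of_forall_mem_sphere_norm_le (f := F) (c := z)
    (C := M * Real.exp (b * (|z.im| + 1))) one_pos hFd.diffContOnCl ?_
  · refine this.trans (le_of_eq ?_)
    rw [div_one, mul_assoc, ← Real.exp_add]; ring_nf
  · intro w hw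
    refine (hFall w).trans ?_
    have h1 : |(w - z).im| ≤ 1 := by
      refine (Complex.abs_im_le_norm _).trans ?_
      simpa [dist_eq_norm] using (le_of_eq hw)
    have h2 : |w.im| ≤ |z.im| + 1 := by
      rw [Complex.sub_im] at h1
      have := abs_add_le (w.im - z.im) z.im
      rw [sub_add_cancel] at this
      linarith
    gcongr

lemma aux_contour (h : ℂ → ℂ) (hh : Differentiable ℂ h) (M : ℝ)
    (hM : ∀ z : ℂ, 0 ≤ z.im → ‖h z‖ ≤ M) (N : ℕ) (hN : 1 ≤ N) :
    ∃ Q : ℂ → ℂ, Differentiable ℂ Q ∧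
      (∀ z, h z = (∑ i ∈ Finset.range (N + 1), (z ^ i / (i ! : ℂ)) * iteratedDeriv i h 0)
        + z ^ (N + 1) * Q z) ∧
      Tendsto (fun R : ℝ => ∫ x in (-R)..R, Q x) atTop
        (nhds (Complex.I * Real.pi * (iteratedDeriv N h 0 / (N ! : ℂ)))) := by
  obtain ⟨Q, hQa, hQ⟩ := (hh.analyticAt 0).exists_eq_sum_add_pow_mul (N + 1)
  simp only [smul_eq_mul] at hQ
  have hQd : Differentiable ℂ Q := by
    intro z
    by_cases hz : z = 0
    · rw [hz]; exact hQa.differentiableAt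
    have h1 : Q =ᶠ[nhds z] fun z => (h z - ∑ i ∈ Finset.range (N + 1),
        (z ^ i / (i ! : ℂ)) * iteratedDeriv i h 0) / z ^ (N + 1) := by
      filter_upwards [isOpen_ne.mem_nhds hz] with w hw
      have hw : w ≠ 0 := hw
      rw [hQ w]
      field_simp
      ring
    refine DifferentiableAt.congr_of_eventuallyEq ?_ h1
    refine DifferentiableAt.div ?_ (by fun_prop) (pow_ne_zero _ hz)
    exact (hh z).sub (by fun_prop)
  refine ⟨Q, hQd, hQ, ?_⟩
  obtain ⟨G, hG⟩ := hQd.isExactOn_univ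
  replace hG : ∀ z, HasDerivAt G (Q z) z := fun z => hG z trivial
  set p : ℕ → ℂ := fun i => iteratedDeriv i h 0 / (i ! : ℂ) with hp
  set K : ℝ := M + ∑ i ∈ Finset.range N, ‖p i‖ with hK
  have hM0 : 0 ≤ M := (norm_nonneg _).trans (hM 0 (by simp))
  have key : ∀ z : ℂ, 1 ≤ ‖z‖ → 0 ≤ z.im → ‖z * Q z + p N‖ ≤ K / ‖z‖ := by
    intro z hz1 hz2
    have hz : z ≠ 0 := by
      intro h0; rw [h0] at hz1; norm_num at hz1
    have e1 : z * Q z + p N = (h z - ∑ i ∈ Finset.range N, p i * z ^ i) / z ^ N := by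
      rw [eq_div_iff (pow_ne_zero _ hz), hQ z, Finset.sum_range_succ]
      have : ∑ i ∈ Finset.range N, (z ^ i / (i ! : ℂ)) * iteratedDeriv i h 0
          = ∑ i ∈ Finset.range N, p i * z ^ i :=
        Finset.sum_congr rfl fun i _ => by simp only [hp]; ring
      rw [this]
      simp only [hp]
      ring
    obtain ⟨N', rfl⟩ : ∃ N', N = N' + 1 := ⟨N - 1, by omega⟩
    rw [e1, norm_div, norm_pow, pow_succ, ← div_div]
    gcongr
    rw [div_le_iff₀ (by positivity)]
    refine (norm_sub_le _ _).trans ?_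
    rw [hK, add_mul]
    have h1 : (1:ℝ) ≤ ‖z‖ ^ N' := one_le_pow₀ hz1
    refine add_le_add ((hM z hz2).trans (by nlinarith)) ?_
    refine (norm_sum_le _ _).trans ?_
    rw [Finset.sum_mul]
    refine Finset.sum_le_sum fun i hi => ?_
    rw [norm_mul, norm_pow]
    have : i ≤ N' := by have := Finset.mem_range.1 hi; omega
    gcongr
  rw [tendsto_iff_norm_sub_tendsto_zero]
  have hlim : Tendsto (fun R : ℝ => K / R * |Real.pi - 0|) atTop (nhds 0) := by
    have := (tendsto_const_nhds (x := K)).div_atTop (tendsto_id (α := ℝ) (x := atTop))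
    simpa using this.mul_const |Real.pi - 0|
  refine squeeze_zero' (Eventually.of_forall fun _ => norm_nonneg _) ?_ hlim
  filter_upwards [eventually_ge_atTop 1] with R hR
  have i1 : ∫ x in (-R)..R, Q x = G R - G (-R : ℝ) := by
    apply intervalIntegral.integral_eq_sub_of_hasDerivAt
    · intro t _
      exact (hG t).comp_ofReal
    · exact (hQd.continuous.comp Complex.continuous_ofReal).intervalIntegrable _ _
  have hc : Continuous fun θ => circleMap 0 R θ * Complex.I * Q (circleMap 0 R θ) := by
    have := continuous_circleMap 0 R
    have := hQd.continuous
    fun_prop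
  have i2 : ∫ θ in (0:ℝ)..Real.pi, circleMap 0 R θ * Complex.I * Q (circleMap 0 R θ)
      = G (circleMap 0 R Real.pi) - G (circleMap 0 R 0) := by
    apply intervalIntegral.integral_eq_sub_of_hasDerivAt
      (f := fun θ => G (circleMap 0 R θ))
    · intro t _
      have := (hG (circleMap 0 R t)).comp t (hasDerivAt_circleMap 0 R t)
      rw [mul_comm]
      exact this
    · exact hc.intervalIntegrable _ _
  have c1 : circleMap 0 R Real.pi = ((-R : ℝ) : ℂ) := by simp [circleMap]
  have c2 : circleMap 0 R 0 = (R : ℂ) := by simp [circleMap]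
  rw [c1, c2] at i2
  have i3 : ∫ θ in (0:ℝ)..Real.pi,
      Complex.I * (circleMap 0 R θ * Q (circleMap 0 R θ) + p N)
      = -((∫ x in (-R)..R, Q x) - Complex.I * Real.pi * p N) := by
    have : ∀ θ, Complex.I * (circleMap 0 R θ * Q (circleMap 0 R θ) + p N) =
      circleMap 0 R θ * Complex.I * Q (circleMap 0 R θ) + Complex.I * p N := fun θ => by ring
    simp only [this]
    rw [intervalIntegral.integral_add (hc.intervalIntegrable _ _) (by simp), i2, i1]
    simp
    ring
  rw [← norm_neg, ← i3]
  apply intervalIntegral.norm_integral_le_of_norm_le_const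
  intro θ hθ
  rw [Set.uIoc_of_le Real.pi_pos.le] at hθ
  have hn : ‖circleMap 0 R θ‖ = R := by
    rw [norm_circleMap_zero, abs_of_nonneg (by linarith)]
  have := key (circleMap 0 R θ) (by rw [hn]; exact hR) (by
    have := Real.sin_nonneg_of_nonneg_of_le_pi hθ.1.le hθ.2
    have : 0 ≤ R * Real.sin θ := by positivity
    simpa [circleMap, Complex.exp_im] using this)
  rw [norm_mul, Complex.norm_I, one_mul]
  rwa [hn] at this

noncomputable def auxU (m : ℕ) (lam : ℝ) (z : ℂ) : ℂ :=
  ∑ k ∈ Finset.range m, ((-1 : ℂ) ^ m * (-1) ^ k * ((2 * m).choose k : ℂ) / 2 ^ (2 * m)) *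
    Complex.exp ((2 * ((m : ℂ) - k) * lam * Complex.I) * z)

lemma aux_sin (m : ℕ) (lam : ℝ) (z : ℂ) :
    Complex.sin (lam * z) ^ (2 * m) =
      (-1 : ℂ) ^ m * (-1) ^ m * ((2 * m).choose m : ℂ) / 2 ^ (2 * m)
        + auxU m lam z + auxU m lam (-z) := by
  set g : ℕ → ℂ := fun k => ((-1 : ℂ) ^ m * (-1) ^ k * ((2 * m).choose k : ℂ) / 2 ^ (2 * m)) *
    Complex.exp ((2 * ((m : ℂ) - k) * lam * Complex.I) * z) with hg
  have h1 : Complex.sin (lam * z) ^ (2 * m) = ∑ k ∈ Finset.range (2 * m + 1), g k := by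
    have e : Complex.sin (lam * z) = (-Complex.exp (-(lam * z) * Complex.I) +
        Complex.exp (lam * z * Complex.I)) * (Complex.I / 2) * (-1) := by
      rw [Complex.sin]; ring
    rw [e, mul_pow, mul_pow, add_pow, Finset.sum_mul, Finset.sum_mul]
    refine Finset.sum_congr rfl fun k hk => ?_
    have hk' : k ≤ 2 * m := by have := Finset.mem_range.1 hk; omega
    simp only [hg]
    rw [neg_pow, ← Complex.exp_nat_mul, ← Complex.exp_nat_mul, div_pow, pow_mul Complex.I,
      Complex.I_sq, pow_mul (-1 : ℂ) 2 m]
    have e2 : Complex.exp ((2 * ((m : ℂ) - k) * lam * Complex.I) * z) =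
        Complex.exp (k * (-(lam * z) * Complex.I)) *
          Complex.exp (((2 * m - k : ℕ) : ℂ) * (lam * z * Complex.I)) := by
      rw [← Complex.exp_add]
      congr 1
      push_cast [Nat.cast_sub hk']
      ring
    rw [e2]
    norm_num
    ring
  have h2 : ∑ k ∈ Finset.range (2 * m + 1), g k =
      ∑ k ∈ Finset.range m, g k + (g m + ∑ k ∈ Finset.range m, g (2 * m - k)) := by
    have : 2 * m + 1 = m + (m + 1) := by ring
    rw [this, Finset.sum_range_add, Finset.sum_range_succ' (fun x => g (m + x)), add_comm (g m)]
    congr 2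
    rw [← Finset.sum_range_reflect]
    refine Finset.sum_congr rfl fun k hk => ?_
    have := Finset.mem_range.1 hk
    congr 1
    omega
  have h3 : g m = (-1 : ℂ) ^ m * (-1) ^ m * ((2 * m).choose m : ℂ) / 2 ^ (2 * m) := by
    simp [hg]
  have h4 : ∑ k ∈ Finset.range m, g (2 * m - k) = auxU m lam (-z) := by
    refine Finset.sum_congr rfl fun k hk => ?_
    have hk' : k ≤ 2 * m := by have := Finset.mem_range.1 hk; omega
    simp only [hg]
    rw [Nat.choose_symm hk', Nat.cast_sub hk']
    have : (-1 : ℂ) ^ (2 * m - k) = (-1) ^ k := by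
      have e : (-1 : ℂ) ^ (2 * m - k) * (-1) ^ k = 1 := by
        rw [← pow_add, Nat.sub_add_cancel hk', pow_mul]; norm_num
      have e' : (-1 : ℂ) ^ k * (-1) ^ k = 1 := by
        rw [← mul_pow]; norm_num
      have hne : (-1 : ℂ) ^ k ≠ 0 := by simp
      exact mul_right_cancel₀ hne (e.trans e'.symm)
    rw [this]
    congr 2
    push_cast
    ring
  rw [h1, h2, h3, h4]
  change auxU m lam z + _ = _
  ring

lemma auxU_diff (m : ℕ) (lam : ℝ) : Differentiable ℂ (auxU m lam) := by
  unfold auxU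
  fun_prop

lemma auxU_deriv (m : ℕ) (lam : ℝ) (j : ℕ) : iteratedDeriv j (auxU m lam) 0 =
    ∑ k ∈ Finset.range m, ((-1 : ℂ) ^ m * (-1) ^ k * ((2 * m).choose k : ℂ) / 2 ^ (2 * m)) *
      (2 * ((m : ℂ) - k) * lam * Complex.I) ^ j := by
  unfold auxU
  rw [iteratedDeriv_fun_sum (fun i _ => by fun_prop)]
  refine Finset.sum_congr rfl fun k _ => ?_
  rw [iteratedDeriv_const_mul_field]
  simp

lemma auxU_bound (m : ℕ) (lam b : ℝ) (hb : b ≤ 2 * lam) (hb0 : 0 < b) :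
    ∃ K : ℝ, 0 ≤ K ∧ ∀ z : ℂ, 0 ≤ z.im → ‖auxU m lam z‖ ≤ K * Real.exp (-(b * z.im)) := by
  refine ⟨∑ k ∈ Finset.range m,
    ‖((-1 : ℂ) ^ m * (-1) ^ k * ((2 * m).choose k : ℂ) / 2 ^ (2 * m))‖,
    Finset.sum_nonneg fun _ _ => norm_nonneg _, fun z hz => ?_⟩
  unfold auxU
  refine (norm_sum_le _ _).trans ?_
  rw [Finset.sum_mul]
  refine Finset.sum_le_sum fun k hk => ?_
  rw [norm_mul]
  gcongr
  rw [Complex.norm_exp]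
  gcongr
  have hk' : (k : ℝ) + 1 ≤ m := by exact_mod_cast Finset.mem_range.1 hk
  have e : ((2 * ((m : ℂ) - k) * lam * Complex.I) * z).re = -(2 * ((m : ℝ) - k) * lam * z.im) := by
    have : (2 * ((m : ℂ) - k) * lam * Complex.I) * z =
      ((2 * ((m : ℝ) - k) * lam : ℝ) : ℂ) * (Complex.I * z) := by push_cast; ring
    rw [this, Complex.re_ofReal_mul]
    simp
  rw [e]
  have : b ≤ 2 * ((m : ℝ) - k) * lam := by nlinarith
  have := mul_le_mul_of_nonneg_right this hz
  linarith


/-- Difference form of Theorem 1: the λ-independent finite-part term cancels. -/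
theorem sinc_transform_even_difference
    (f : ℂ → ℂ) (τ : ℝ) (hτ : 0 < τ)
    (hf : Differentiable ℂ f)
    (htype : ∀ ε > 0, ∃ C > 0, ∀ z : ℂ, ‖f z‖ ≤ C * Real.exp ((τ + ε) * ‖z‖))
    (heven : ∀ z : ℂ, f (-z) = f z)
    (hint : Integrable (fun x : ℝ => f x))
    (m : ℕ) (hm : 1 ≤ m) (lam₁ lam₂ : ℝ) (hlam₁ : τ / 2 < lam₁) (hlam₂ : τ / 2 < lam₂) :
    (∫ x in Set.Ioi (0 : ℝ),
        f x * ((((Real.sin (lam₁ * x)) ^ (2 * m) - (Real.sin (lam₂ * x)) ^ (2 * m)) /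
          x ^ (2 * m) : ℝ) : ℂ))
      = -((Real.pi : ℂ) * (-1 : ℂ) ^ m * ((2 * m)! : ℂ) / 2 ^ (2 * m)) *
          ∑ l ∈ Finset.range m,
            (((-1 : ℂ) ^ l * 2 ^ (2 * l + 1) * iteratedDeriv (2 * m - 2 * l - 2) f 0 /
                (((2 * l + 1)! : ℂ) * ((2 * m - 2 * l - 2)! : ℂ))) *
              ∑ k ∈ Finset.range m,
                (-1 : ℂ) ^ k * ((m : ℂ) - (k : ℂ)) ^ (2 * l + 1) /
                  ((k ! : ℂ) * ((2 * m - k)! : ℂ))) *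
            ((lam₁ : ℂ) ^ (2 * l + 1) - (lam₂ : ℂ) ^ (2 * l + 1)) := by
  set N := 2 * m - 1 with hNdef
  have hN1 : N + 1 = 2 * m := by omega
  set b := min (2 * lam₁) (2 * lam₂) with hb
  have hbτ : τ < b := lt_min (by linarith) (by linarith)
  have hb0 : 0 < b := hτ.trans hbτ
  obtain ⟨M, hM⟩ := aux_bound f τ b hτ hbτ hf htype heven hint
  obtain ⟨K₁, hK₁, hU₁⟩ := auxU_bound m lam₁ b (min_le_left _ _) hb0
  obtain ⟨K₂, hK₂, hU₂⟩ := auxU_bound m lam₂ b (min_le_right _ _) hb0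
  set U : ℂ → ℂ := fun z => auxU m lam₁ z - auxU m lam₂ z with hU
  have hUd : Differentiable ℂ U := (auxU_diff m lam₁).sub (auxU_diff m lam₂)
  set h : ℂ → ℂ := fun z => f z * U z with hh
  have hhd : Differentiable ℂ h := hf.mul hUd
  have hM0 : 0 ≤ M := by
    have := (norm_nonneg _).trans (hM 0)
    simpa using this
  have hbd : ∀ z : ℂ, 0 ≤ z.im → ‖h z‖ ≤ M * (K₁ + K₂) := by
    intro z hz
    have h1 := hM z
    rw [abs_of_nonneg hz] at h1
    have h2 : ‖U z‖ ≤ (K₁ + K₂) * Real.exp (-(b * z.im)) := by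
      refine (norm_sub_le _ _).trans ?_
      rw [add_mul]
      exact add_le_add (hU₁ z hz) (hU₂ z hz)
    simp only [hh]
    rw [norm_mul]
    calc _ ≤ (M * Real.exp (b * z.im)) * ((K₁ + K₂) * Real.exp (-(b * z.im))) := by gcongr
      _ = M * (K₁ + K₂) * (Real.exp (b * z.im) * Real.exp (-(b * z.im))) := by ring
      _ = _ := by rw [← Real.exp_add]; simp
  obtain ⟨Q, hQd, hQ, hlim⟩ := aux_contour h hhd _ hbd N (by omega)
  have hsum : ∀ z, h z + h (-z) =
      f z * (Complex.sin (lam₁ * z) ^ (2 * m) - Complex.sin (lam₂ * z) ^ (2 * m)) := by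
    intro z
    simp only [hh, hU, heven]
    rw [aux_sin, aux_sin]
    ring
  -- the even Taylor coefficients of h vanish
  have hcoef : ∀ i < 2 * m, iteratedDeriv i h 0 + (-1) ^ i * iteratedDeriv i h 0 = 0 := by
    intro i hi
    have hsa : ∀ lam : ℝ, AnalyticAt ℂ (fun z : ℂ => Complex.sin (lam * z)) 0 := fun lam =>
      (by fun_prop : Differentiable ℂ fun z : ℂ => Complex.sin (lam * z)).analyticAt 0
    have hso : ∀ lam : ℝ, ((2 * m : ℕ) : ℕ∞) ≤
        analyticOrderAt ((fun z : ℂ => Complex.sin (lam * z)) ^ (2 * m)) 0 := by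
      intro lam
      rw [analyticOrderAt_pow (hsa lam)]
      have : (1 : ℕ∞) ≤ analyticOrderAt (fun z : ℂ => Complex.sin (lam * z)) 0 := by
        rw [Order.one_le_iff_ne_zero, (hsa lam).analyticOrderAt_ne_zero]
        simp
      simpa using mul_le_mul_right this ((2 * m : ℕ) : ℕ∞)
    have hga : AnalyticAt ℂ (fun z => h z + h (-z)) 0 :=
      (hhd.add (hhd.comp differentiable_neg)).analyticAt 0
    have hgo : ((2 * m : ℕ) : ℕ∞) ≤ analyticOrderAt (fun z => h z + h (-z)) 0 := by
      have e : (fun z => h z + h (-z)) =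
        f * ((fun z : ℂ => Complex.sin (lam₁ * z)) ^ (2 * m) -
          (fun z : ℂ => Complex.sin (lam₂ * z)) ^ (2 * m)) := by
        funext z; rw [hsum z]; simp
      rw [e, analyticOrderAt_mul (hf.analyticAt 0)
        (((hsa lam₁).pow _).sub ((hsa lam₂).pow _))]
      refine le_add_left ?_
      exact (le_min (hso lam₁) (hso lam₂)).trans (le_analyticOrderAt_sub)
    have h0 := (natCast_le_analyticOrderAt_iff_iteratedDeriv_eq_zero hga).1 hgo i hi
    have hneg : Differentiable ℂ (fun z => h (-z)) := hhd.comp differentiable_neg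
    rw [iteratedDeriv_fun_add hhd.contDiff.contDiffAt hneg.contDiff.contDiffAt, iteratedDeriv_comp_neg] at h0
    simpa using h0
  have hQsum : ∀ x : ℝ, x ≠ 0 → Q x + Q (-x : ℝ) = f x * ((((Real.sin (lam₁ * x)) ^ (2 * m)
      - (Real.sin (lam₂ * x)) ^ (2 * m)) / x ^ (2 * m) : ℝ) : ℂ) := by
    intro x hx
    have hx' : (x : ℂ) ≠ 0 := by exact_mod_cast hx
    have h1 := hQ x
    have h2 := hQ (-x)
    have h3 := hsum x
    have h4 : (∑ i ∈ Finset.range (N + 1), ((x:ℂ) ^ i / (i ! : ℂ)) * iteratedDeriv i h 0) +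
        (∑ i ∈ Finset.range (N + 1), ((-x:ℂ) ^ i / (i ! : ℂ)) * iteratedDeriv i h 0) = 0 := by
      rw [← Finset.sum_add_distrib]
      refine Finset.sum_eq_zero fun i hi => ?_
      have := hcoef i (by have := Finset.mem_range.1 hi; omega)
      rw [neg_pow (x : ℂ)]
      linear_combination ((x:ℂ) ^ i / (i ! : ℂ)) * this
    rw [hN1] at h1 h2 h4
    have h5 : (-x : ℂ) ^ (2 * m) = (x : ℂ) ^ (2 * m) := by rw [pow_mul, neg_sq, ← pow_mul]
    rw [h5] at h2
    push_cast
    rw [mul_div_assoc', eq_div_iff (pow_ne_zero _ hx')]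
    linear_combination h3 - h1 - h2 - h4
  -- integrability
  have hint' : IntegrableOn (fun x : ℝ => f x * ((((Real.sin (lam₁ * x)) ^ (2 * m)
      - (Real.sin (lam₂ * x)) ^ (2 * m)) / x ^ (2 * m) : ℝ) : ℂ)) (Set.Ioi 0) := by
    apply Integrable.integrableOn
    apply hint.mul_bdd (c := |lam₁| ^ (2 * m) + |lam₂| ^ (2 * m))
    · apply Measurable.aestronglyMeasurable
      fun_prop
    · refine Eventually.of_forall fun x => ?_
      rw [Complex.norm_real, Real.norm_eq_abs, sub_div, ← div_pow, ← div_pow]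
      have hs : ∀ lam : ℝ, |Real.sin (lam * x) / x| ≤ |lam| := by
        intro lam
        rw [abs_div]
        refine div_le_of_le_mul₀ (abs_nonneg _) (abs_nonneg _) ?_
        rw [← abs_mul]
        exact Real.abs_sin_le_abs
      refine (abs_sub _ _).trans ?_
      rw [abs_pow, abs_pow]
      exact add_le_add (pow_le_pow_left₀ (abs_nonneg _) (hs _) _)
        (pow_le_pow_left₀ (abs_nonneg _) (hs _) _)
  have hlim2 := intervalIntegral_tendsto_integral_Ioi 0 hint' tendsto_id
  have hQi : ∀ a c : ℝ, IntervalIntegrable (fun x : ℝ => Q x) volume a c := fun a c =>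
    (hQd.continuous.comp Complex.continuous_ofReal).intervalIntegrable _ _
  have hQi' : ∀ a c : ℝ, IntervalIntegrable (fun x : ℝ => Q (-x : ℝ)) volume a c := fun a c =>
    (hQd.continuous.comp (Complex.continuous_ofReal.comp continuous_neg)).intervalIntegrable _ _
  have heq : (fun R : ℝ => ∫ x in (-R)..R, Q x) = fun R : ℝ => ∫ x in (0:ℝ)..(id R),
      f x * ((((Real.sin (lam₁ * x)) ^ (2 * m)
      - (Real.sin (lam₂ * x)) ^ (2 * m)) / x ^ (2 * m) : ℝ) : ℂ) := by
    funext R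
    have e1 : ∫ x in (0:ℝ)..(id R), f x * ((((Real.sin (lam₁ * x)) ^ (2 * m)
      - (Real.sin (lam₂ * x)) ^ (2 * m)) / x ^ (2 * m) : ℝ) : ℂ) =
      ∫ x in (0:ℝ)..R, (Q x + Q (-x : ℝ)) := by
      apply intervalIntegral.integral_congr_ae
      filter_upwards [Measure.ae_ne volume 0] with x hx _
      exact (hQsum x hx).symm
    rw [e1, intervalIntegral.integral_add (hQi _ _) (hQi' _ _),
      intervalIntegral.integral_comp_neg (fun x : ℝ => Q x), neg_zero, add_comm,
      intervalIntegral.integral_add_adjacent_intervals (hQi _ _) (hQi _ _)]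
  rw [heq] at hlim
  rw [tendsto_nhds_unique hlim2 hlim]
  -- compute the coefficient
  have hUn : ∀ j, iteratedDeriv j U 0 = ∑ k ∈ Finset.range m,
      ((-1 : ℂ) ^ m * (-1) ^ k * ((2 * m).choose k : ℂ) / 2 ^ (2 * m)) *
      (2 * ((m : ℂ) - k) * Complex.I) ^ j * ((lam₁ : ℂ) ^ j - (lam₂ : ℂ) ^ j) := by
    intro j
    simp only [hU]
    rw [iteratedDeriv_fun_sub (auxU_diff m lam₁).contDiff.contDiffAt
      (auxU_diff m lam₂).contDiff.contDiffAt, auxU_deriv, auxU_deriv, ← Finset.sum_sub_distrib]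
    refine Finset.sum_congr rfl fun k _ => ?_
    simp only [mul_pow]
    ring
  have hfodd : ∀ i, Odd i → iteratedDeriv i f 0 = 0 := by
    intro i hi
    have h1 := iteratedDeriv_comp_neg i f 0
    simp only [heven, hi.neg_one_pow, neg_zero, smul_eq_mul] at h1
    linear_combination h1 / 2
  have hhN : iteratedDeriv N h 0 / (N ! : ℂ) = ∑ l ∈ Finset.range m,
      iteratedDeriv (2 * m - 2 * l - 2) f 0 / ((2 * m - 2 * l - 2)! : ℂ) *
        (iteratedDeriv (2 * l + 1) U 0 / ((2 * l + 1)! : ℂ)) := by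
    simp only [hh]
    rw [iteratedDeriv_fun_mul hf.contDiff.contDiffAt hUd.contDiff.contDiffAt, Finset.sum_div]
    set t : ℕ → ℂ := fun i => (N.choose i : ℂ) * iteratedDeriv i f 0 *
      iteratedDeriv (N - i) U 0 / (N ! : ℂ) with ht
    change ∑ i ∈ Finset.range (N + 1), t i = _
    have e1 : ∑ i ∈ Finset.range (N + 1), t i = ∑ l ∈ Finset.range m, t (2 * l) := by
      rw [hN1]
      have hodd : ∀ l < m, t (2 * l + 1) = 0 := by
        intro l _
        simp only [ht]
        rw [hfodd (2 * l + 1) ⟨l, rfl⟩]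
        simp
      clear_value t
      clear * - hodd
      induction m with
      | zero => simp
      | succ n ih =>
        rw [show 2 * (n + 1) = 2 * n + 1 + 1 by ring, Finset.sum_range_succ,
          Finset.sum_range_succ, ih (fun l hl => hodd l (by omega)), hodd n (by omega),
          Finset.sum_range_succ, add_zero]
    rw [e1, ← Finset.sum_range_reflect]
    refine Finset.sum_congr rfl fun l hl => ?_
    have hl' := Finset.mem_range.1 hl
    have e2 : 2 * (m - 1 - l) = 2 * m - 2 * l - 2 := by omega
    have e3 : N - (2 * m - 2 * l - 2) = 2 * l + 1 := by omega
    simp only [ht]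
    rw [e2, Nat.cast_choose ℂ (by omega : 2 * m - 2 * l - 2 ≤ N), e3]
    have := Nat.factorial_ne_zero N
    field_simp
  rw [hhN, Finset.mul_sum, Finset.mul_sum]
  refine Finset.sum_congr rfl fun l hl => ?_
  rw [hUn]
  have hI : Complex.I ^ (2 * l + 1) = (-1) ^ l * Complex.I := by
    rw [pow_succ, pow_mul, Complex.I_sq]
  have hS : ∑ k ∈ Finset.range m,
      ((-1 : ℂ) ^ m * (-1) ^ k * ((2 * m).choose k : ℂ) / 2 ^ (2 * m)) *
      (2 * ((m : ℂ) - k) * Complex.I) ^ (2 * l + 1) *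
        ((lam₁ : ℂ) ^ (2 * l + 1) - (lam₂ : ℂ) ^ (2 * l + 1)) =
      ((-1 : ℂ) ^ m * ((2 * m)! : ℂ) / 2 ^ (2 * m) * 2 ^ (2 * l + 1) * ((-1) ^ l * Complex.I) *
        ((lam₁ : ℂ) ^ (2 * l + 1) - (lam₂ : ℂ) ^ (2 * l + 1))) *
      ∑ k ∈ Finset.range m, (-1 : ℂ) ^ k * ((m : ℂ) - (k : ℂ)) ^ (2 * l + 1) /
                  ((k ! : ℂ) * ((2 * m - k)! : ℂ)) := by
    rw [Finset.mul_sum]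
    refine Finset.sum_congr rfl fun k hk => ?_
    have hk' := Finset.mem_range.1 hk
    rw [mul_pow, mul_pow, hI, Nat.cast_choose ℂ (by omega : k ≤ 2 * m)]
    ring
  rw [hS]
  linear_combination (((-1 : ℂ) ^ l * 2 ^ (2 * l + 1) * iteratedDeriv (2 * m - 2 * l - 2) f 0 /
                (((2 * l + 1)! : ℂ) * ((2 * m - 2 * l - 2)! : ℂ))) *
              ∑ k ∈ Finset.range m,
                (-1 : ℂ) ^ k * ((m : ℂ) - (k : ℂ)) ^ (2 * l + 1) /
                  ((k ! : ℂ) * ((2 * m - k)! : ℂ))) *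
            ((lam₁ : ℂ) ^ (2 * l + 1) - (lam₂ : ℂ) ^ (2 * l + 1)) *
            ((Real.pi : ℂ) * (-1 : ℂ) ^ m * ((2 * m)! : ℂ) / 2 ^ (2 * m)) * Complex.I_sq
end

section
/- Let f : ℂ → ℂ be entire of exponential type τ > 0 with f|ℝ Lebesgue integrable on ℝ, let m ≥ 1 be an integer, and let a > τ be real. Then lim_{γ→∞} ∫_{−∞}^{∞} f(x + iγ)·e^{ia(x+iγ)}/(x + iγ)^{2m} dx = 0; indeed, for all sufficiently large γ the modulus of this integral is bounded by a constant times e^{−γ(a−τ′)} for any τ′ with τ < τ′ < a. -/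
open MeasureTheory Filter

lemma shifted_aux_diff (f : ℂ → ℂ) (hf : Differentiable ℂ f) (k : ℝ → ℂ) (hk : Continuous k)
    (K : ℝ) (hK : ∀ t, ‖k t‖ ≤ K) (R : ℝ) :
    Differentiable ℂ (fun z : ℂ => ∫ t in (-R)..R, f (z + t) * k t) := by
  intro z₀
  have hK0 : 0 ≤ K := (norm_nonneg _).trans (hK 0)
  have hd : Continuous (deriv f) :=
    (hf.contDiff (n := 1)).continuous_deriv le_rfl
  have hfc := hf.continuous
  obtain ⟨B, hB⟩ := (isCompact_closedBall (0 : ℂ) (‖z₀‖ + 1 + |R|)).exists_bound_of_continuousOn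
    hd.continuousOn
  have := intervalIntegral.hasDerivAt_integral_of_dominated_loc_of_deriv_le (μ := volume)
    (a := -R) (b := R) (F := fun (z : ℂ) (t : ℝ) => f (z + t) * k t)
    (F' := fun (z : ℂ) (t : ℝ) => deriv f (z + t) * k t) (x₀ := z₀)
    (s := Metric.ball z₀ 1) (bound := fun _ => B * K) (Metric.ball_mem_nhds _ one_pos)
    (Eventually.of_forall fun z => (by fun_prop : Continuous _).aestronglyMeasurable)
    ((by fun_prop : Continuous _).intervalIntegrable _ _)
    ((by fun_prop : Continuous _).aestronglyMeasurable) ?_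
    (by simp) ?_
  · exact this.2.differentiableAt
  · refine Eventually.of_forall fun t ht z hz => ?_
    rw [norm_mul]
    have h1 : ‖deriv f (z + t)‖ ≤ B := by
      apply hB
      rw [mem_closedBall_zero_iff]
      have ht' : |t| ≤ |R| := by
        rcases Set.mem_uIoc.1 ht with h | h
        · exact abs_le_abs h.2 (by linarith)
        · rw [abs_le]; constructor <;> linarith [neg_abs_le R, le_abs_self R]
      have h2 : ‖z‖ ≤ ‖z₀‖ + 1 := by
        have := norm_le_norm_add_norm_sub' z z₀
        rw [Metric.mem_ball, dist_eq_norm] at hz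
        linarith
      calc ‖z + t‖ ≤ ‖z‖ + ‖(t : ℂ)‖ := norm_add_le _ _
        _ ≤ _ := by rw [Complex.norm_real, Real.norm_eq_abs]; linarith
    exact mul_le_mul h1 (hK t) (norm_nonneg _) ((norm_nonneg _).trans h1)
  · refine Eventually.of_forall fun t ht z hz => ?_
    have h := (hf (z + t)).hasDerivAt
    have h2 := h.comp_add_const z (t : ℂ)
    exact h2.mul_const _

lemma shifted_aux_PL (F : ℂ → ℂ) (hF : Differentiable ℂ F) (σ A M : ℝ)
    (hA : ∀ z, ‖F z‖ ≤ A * Real.exp (σ * ‖z‖)) (hM : ∀ x : ℝ, ‖F x‖ ≤ M) (γ : ℝ) (hγ : 0 ≤ γ) :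
    ‖F (Complex.I * γ)‖ ≤ M * Real.exp (σ * γ) := by
  have hA0 : 0 ≤ A := by
    have := (norm_nonneg _).trans (hA 0)
    simpa using this
  have hn : ∀ w : ℂ, ‖F (Complex.I * w) * Complex.exp (-σ * w)‖
      = ‖F (Complex.I * w)‖ * Real.exp (-σ * w.re) := by
    intro w
    rw [norm_mul, Complex.norm_exp]
    simp
  have key : ‖F (Complex.I * γ) * Complex.exp (-σ * γ)‖ ≤ M := by
    refine PhragmenLindelof.right_half_plane_of_bounded_on_real
      (f := fun w : ℂ => F (Complex.I * w) * Complex.exp (-σ * w)) (z := (γ : ℂ)) ?_ ?_ ?_ ?_ ?_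
    · apply Differentiable.diffContOnCl
      fun_prop
    · refine ⟨1, by norm_num, 2 * |σ|, ?_⟩
      refine Asymptotics.IsBigO.of_bound A (Eventually.of_forall fun w => ?_)
      rw [hn, Real.rpow_one, Real.norm_eq_abs, Real.abs_exp]
      calc ‖F (Complex.I * w)‖ * Real.exp (-σ * w.re)
          ≤ (A * Real.exp (σ * ‖Complex.I * w‖)) * Real.exp (-σ * w.re) := by
            gcongr; exact hA _
        _ = A * Real.exp (σ * ‖w‖ + -σ * w.re) := by
            rw [Real.exp_add]; simp [mul_assoc]
        _ ≤ _ := by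
            gcongr
            have h1 : σ * ‖w‖ ≤ |σ| * ‖w‖ := by gcongr; exact le_abs_self _
            have h2 : -σ * w.re ≤ |σ| * ‖w‖ := by
              calc -σ * w.re ≤ |(-σ * w.re)| := le_abs_self _
                _ = |σ| * |w.re| := by rw [abs_mul, abs_neg]
                _ ≤ _ := by gcongr; exact Complex.abs_re_le_norm w
            linarith
    · refine isBoundedUnder_of_eventually_le (a := A) ?_
      filter_upwards [eventually_ge_atTop 0] with x hx
      rw [hn]
      calc ‖F (Complex.I * x)‖ * Real.exp (-σ * (x : ℂ).re)
          ≤ (A * Real.exp (σ * ‖Complex.I * (x : ℂ)‖)) * Real.exp (-σ * (x : ℂ).re) := by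
            gcongr; exact hA _
        _ = A := by
            rw [mul_assoc, ← Real.exp_add]; simp [abs_of_nonneg hx]
    · intro x
      rw [hn]
      have := hM (-x)
      have e : Complex.I * (x * Complex.I) = ((-x : ℝ) : ℂ) := by
        push_cast; linear_combination (x : ℂ) * Complex.I_mul_I
      rw [e]
      simpa using this
    · simpa using hγ
  rw [hn] at key
  calc ‖F (Complex.I * γ)‖
      = ‖F (Complex.I * γ)‖ * Real.exp (-σ * (γ : ℂ).re) * Real.exp (σ * γ) := by
        rw [mul_assoc, ← Real.exp_add]; simp
    _ ≤ _ := by gcongr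

lemma shifted_aux_bound (f : ℂ → ℂ) (hf : Differentiable ℂ f) (σ C : ℝ) (hσ : 0 ≤ σ)
    (hC : ∀ z : ℂ, ‖f z‖ ≤ C * Real.exp (σ * ‖z‖))
    (hint : Integrable (fun x : ℝ => f x)) (k : ℝ → ℂ) (hk : Continuous k)
    (K : ℝ) (hK : ∀ t, ‖k t‖ ≤ K) (γ : ℝ) (hγ : 0 ≤ γ) :
    ‖∫ x : ℝ, f ((x : ℂ) + Complex.I * γ) * k x‖
      ≤ K * (∫ x : ℝ, ‖f x‖) * Real.exp (σ * γ) := by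
  have hK0 : 0 ≤ K := (norm_nonneg _).trans (hK 0)
  have hC0 : 0 ≤ C := by
    have := (norm_nonneg _).trans (hC 0)
    simpa using this
  have hfc := hf.continuous
  by_cases hi : Integrable (fun x : ℝ => f ((x : ℂ) + Complex.I * γ) * k x)
  swap
  · rw [integral_undef hi, norm_zero]
    have : 0 ≤ ∫ x : ℝ, ‖f x‖ := integral_nonneg fun _ => norm_nonneg _
    positivity
  have ht := (intervalIntegral_tendsto_integral hi tendsto_neg_atTop_atBot tendsto_id).norm
  refine le_of_tendsto ht ?_
  filter_upwards [eventually_ge_atTop 0] with R hR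
  have := shifted_aux_PL (fun z : ℂ => ∫ t in (-R)..R, f (z + t) * k t)
    (shifted_aux_diff f hf k hk K hK R) σ (C * Real.exp (σ * R) * K * (2 * R))
    (K * ∫ x : ℝ, ‖f x‖) ?_ ?_ γ hγ
  · simpa [add_comm] using this
  · intro z
    have := intervalIntegral.norm_integral_le_of_norm_le_const (a := -R) (b := R)
      (f := fun t : ℝ => f (z + t) * k t) (C := C * Real.exp (σ * (‖z‖ + R)) * K) ?_
    · refine this.trans (le_of_eq ?_)
      rw [mul_add, Real.exp_add, abs_of_nonneg (by linarith)]
      ring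
    · intro t ht
      rw [Set.uIoc_of_le (by linarith)] at ht
      rw [norm_mul]
      have h1 : ‖z + t‖ ≤ ‖z‖ + R := by
        refine (norm_add_le _ _).trans ?_
        rw [Complex.norm_real, Real.norm_eq_abs]
        have := abs_le.2 ⟨ht.1.le, ht.2⟩
        linarith
      have h2 : ‖f (z + t)‖ ≤ C * Real.exp (σ * (‖z‖ + R)) := (hC _).trans (by gcongr)
      exact mul_le_mul h2 (hK t) (norm_nonneg _) (by positivity)
  · intro x
    have hx : Integrable (fun t : ℝ => K * ‖f ((x : ℂ) + t)‖) := by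
      have := (hint.norm.comp_add_left x).const_mul K
      simpa using this
    calc ‖∫ t in (-R)..R, f ((x : ℂ) + t) * k t‖
        ≤ ∫ t in (-R)..R, K * ‖f ((x : ℂ) + t)‖ := by
          refine intervalIntegral.norm_integral_le_of_norm_le (by linarith)
            (Eventually.of_forall fun t _ => ?_) hx.intervalIntegrable
          rw [norm_mul, mul_comm]
          gcongr
          exact hK t
      _ ≤ ∫ t : ℝ, K * ‖f ((x : ℂ) + t)‖ := by
          rw [intervalIntegral.integral_of_le (by linarith)]
          exact setIntegral_le_integral hx (Eventually.of_forall fun t => by positivity)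
      _ = K * ∫ x : ℝ, ‖f x‖ := by
          rw [integral_const_mul]
          congr 1
          have := integral_add_left_eq_self (μ := volume) (fun t : ℝ => ‖f t‖) x
          simpa using this



/-- The shifted-contour integral `∫_{-∞}^∞ f(x+iγ) e^{ia(x+iγ)}/(x+iγ)^{2m} dx` tends to `0`
as `γ → ∞` when `a > τ`, with an exponentially small bound `C e^{-γ(a-τ')}` for any
`τ < τ' < a`. -/
theorem shifted_contour_integral_tendsto_zero
    (f : ℂ → ℂ) (τ : ℝ) (hτ : 0 < τ)
    (hf : Differentiable ℂ f)
    (htype : ∀ ε > 0, ∃ C > 0, ∀ z : ℂ, ‖f z‖ ≤ C * Real.exp ((τ + ε) * ‖z‖))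
    (hint : Integrable (fun x : ℝ => f x))
    (m : ℕ) (hm : 1 ≤ m) (a : ℝ) (ha : τ < a) :
    Tendsto
      (fun γ : ℝ =>
        ∫ x : ℝ,
          f ((x : ℂ) + Complex.I * (γ : ℂ)) *
            Complex.exp (Complex.I * (a : ℂ) * ((x : ℂ) + Complex.I * (γ : ℂ))) /
              ((x : ℂ) + Complex.I * (γ : ℂ)) ^ (2 * m))
      atTop (nhds 0) ∧
    ∀ τ' : ℝ, τ < τ' → τ' < a →
      ∃ C > 0, ∃ γ₀ : ℝ, ∀ γ : ℝ, γ₀ ≤ γ →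
        ‖∫ x : ℝ,
            f ((x : ℂ) + Complex.I * (γ : ℂ)) *
              Complex.exp (Complex.I * (a : ℂ) * ((x : ℂ) + Complex.I * (γ : ℂ))) /
                ((x : ℂ) + Complex.I * (γ : ℂ)) ^ (2 * m)‖
          ≤ C * Real.exp (-γ * (a - τ')) := by

  have main : ∀ τ' : ℝ, τ < τ' → τ' < a →
      ∃ C > 0, ∃ γ₀ : ℝ, ∀ γ : ℝ, γ₀ ≤ γ →
        ‖∫ x : ℝ,
            f ((x : ℂ) + Complex.I * (γ : ℂ)) *
              Complex.exp (Complex.I * (a : ℂ) * ((x : ℂ) + Complex.I * (γ : ℂ))) /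
                ((x : ℂ) + Complex.I * (γ : ℂ)) ^ (2 * m)‖
          ≤ C * Real.exp (-γ * (a - τ')) := by
    intro τ' h1 h2
    obtain ⟨C, hC0, hC⟩ := htype (τ' - τ) (by linarith)
    have hJ : 0 ≤ ∫ x : ℝ, ‖f x‖ := integral_nonneg fun _ => norm_nonneg _
    refine ⟨(∫ x : ℝ, ‖f x‖) + 1, by linarith, 1, fun γ hγ => ?_⟩
    have hge : ∀ x : ℝ, 1 ≤ ‖(x : ℂ) + Complex.I * (γ : ℂ)‖ := by
      intro x
      have := (le_abs_self _).trans (Complex.abs_im_le_norm ((x : ℂ) + Complex.I * (γ : ℂ)))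
      simp at this
      linarith
    have hb := shifted_aux_bound f hf τ' C (by linarith) (by simpa using hC) hint
      (fun x : ℝ => Complex.exp (Complex.I * (a : ℂ) * ((x : ℂ) + Complex.I * (γ : ℂ))) /
                ((x : ℂ) + Complex.I * (γ : ℂ)) ^ (2 * m)) ?_ (Real.exp (-(a * γ))) ?_ γ
                (by linarith)
    · simp only [mul_div_assoc]
      refine hb.trans ?_
      calc Real.exp (-(a * γ)) * (∫ x : ℝ, ‖f x‖) * Real.exp (τ' * γ)
          = (∫ x : ℝ, ‖f x‖) * Real.exp (-γ * (a - τ')) := by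
            rw [show -γ * (a - τ') = -(a * γ) + τ' * γ by ring, Real.exp_add]; ring
        _ ≤ _ := by gcongr; linarith
    · refine Continuous.div (by fun_prop) (by fun_prop) fun x => pow_ne_zero _ ?_
      intro h
      have := hge x
      rw [h, norm_zero] at this
      linarith
    · intro x
      rw [norm_div, norm_pow, Complex.norm_exp]
      have e : (Complex.I * (a : ℂ) * ((x : ℂ) + Complex.I * (γ : ℂ))).re = -(a * γ) := by
        simp
      rw [e]
      exact div_le_self (Real.exp_pos _).le (one_le_pow₀ (hge x))
  refine ⟨?_, main⟩
  obtain ⟨C, hC, γ₀, h⟩ := main ((τ + a) / 2) (by linarith) (by linarith)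
  refine squeeze_zero_norm' ((eventually_ge_atTop γ₀).mono h) ?_
  have h1 : Tendsto (fun γ : ℝ => -γ * (a - (τ + a) / 2)) atTop atBot :=
    tendsto_neg_atTop_atBot.atBot_mul_const (by linarith)
  simpa using (Real.tendsto_exp_atBot.comp h1).const_mul C
end

section
/- Let τ > 0, σ > 0 and λ > τ be real. Then ∫₀^∞ (sin(√(τ²x² + σ²))/√(τ²x² + σ²)) · sin³(λx)/x³ dx = (π·τ²/(8σ³))·(σ·cos(σ) − sin(σ)) + (3π·λ²/(8σ))·sin(σ). -/
open MeasureTheory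

lemma exists_S : ∃ S : ℂ → ℂ, Differentiable ℂ S ∧ ∀ s, S (s^2) * s = Complex.sin s := by
  refine ⟨fun w => ∑' n : ℕ, (-1)^n * w^n / ((2*n+1).factorial : ℂ), ?_, ?_⟩
  · intro w
    have h := Complex.differentiableOn_tsum_of_summable_norm (U := Metric.ball (0:ℂ) (‖w‖+1))
      (F := fun (n:ℕ) w => (-1)^n * w^n / ((2*n+1).factorial : ℂ))
      (u := fun n => (‖w‖+1)^n / (n.factorial:ℝ)) (Real.summable_pow_div_factorial _)
      (fun i => by fun_prop) Metric.isOpen_ball ?_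
    · exact h.differentiableAt (Metric.isOpen_ball.mem_nhds (by simp))
    · intro n v hv
      have hv' : ‖v‖ ≤ ‖w‖+1 := by simpa using (mem_ball_zero_iff.1 hv).le
      simp only [norm_div, norm_mul, norm_pow, norm_neg, norm_one, one_pow, one_mul,
        Complex.norm_natCast]
      gcongr
      omega
  · intro s
    have h := Complex.hasSum_sin s
    rw [← h.tsum_eq, ← tsum_mul_right]
    congr 1
    ext n
    rw [pow_add, pow_mul]
    ring

lemma exists_two (g : ℂ → ℂ) (hg : Differentiable ℂ g) (a : ℂ) : ∃ k : ℂ → ℂ, Differentiable ℂ k ∧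
    (∀ w, g w = g a + (w - a) * k w) ∧ k a = deriv g a := by
  refine ⟨dslope g a, ?_, ?_, dslope_same g a⟩
  · rw [← differentiableOn_univ]
    exact (Complex.differentiableOn_dslope Filter.univ_mem).2 hg.differentiableOn
  · intro w
    have := sub_smul_dslope g a w
    rw [smul_eq_mul] at this
    rw [this]; ring

lemma norm_sin_le' (s : ℂ) : ‖Complex.sin s‖ ≤ Real.exp |s.im| := by
  have h1 : ‖Complex.exp (-s * Complex.I)‖ ≤ Real.exp |s.im| := by
    rw [Complex.norm_exp]; apply Real.exp_le_exp.2; simp; exact le_abs_self _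
  have h2 : ‖Complex.exp (s * Complex.I)‖ ≤ Real.exp |s.im| := by
    rw [Complex.norm_exp]; apply Real.exp_le_exp.2; simp; exact neg_le_abs _
  rw [Complex.sin]
  simp only [norm_div, norm_mul, Complex.norm_I, mul_one, Complex.norm_ofNat]
  have := norm_sub_le (Complex.exp (-s * Complex.I)) (Complex.exp (s * Complex.I))
  linarith

lemma im_bound (τ σ : ℝ) (hτ : 0 < τ) (hσ : 0 < σ) (z s : ℂ) (hs : s^2 = τ^2*z^2+σ^2)
    : |s.im| ≤ τ * |z.im| := by
  obtain ⟨u, v⟩ := s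
  obtain ⟨x, y⟩ := z
  have h1 := congrArg Complex.re hs
  have h2 := congrArg Complex.im hs
  simp [pow_two] at h1 h2
  by_contra hc
  simp only [not_le] at hc
  have hc2 : τ^2*y^2 < v^2 := by
    have := mul_self_lt_mul_self (by positivity) hc
    nlinarith [abs_mul_abs_self y, abs_mul_abs_self v]
  have h3 : u*v = τ^2*(x*y) := by linarith
  have h4 : u^2*v^2 = τ^2*x^2*(τ^2*y^2) := by
    rw [← mul_pow, h3]; ring
  have h5 : τ^2*x^2 < u^2 := by nlinarith
  have h6 : τ^2*x^2*(τ^2*y^2) < u^2*v^2 := by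
    apply mul_lt_mul'' h5 hc2 <;> positivity
  linarith

/-- expansions of the exponential part -/
lemma exists_exp3 : ∃ e : ℂ → ℂ, Differentiable ℂ e ∧ 
    ∀ z, Complex.exp z = 1 + z + z^2/2 + z^3 * e z := by
  obtain ⟨a, ha, ha1, ha2⟩ := exists_two Complex.exp Complex.differentiable_exp 0
  obtain ⟨b, hb, hb1, hb2⟩ := exists_two a ha 0
  obtain ⟨c, hc, hc1, hc2⟩ := exists_two b hb 0
  have hd : deriv a 0 = 1/2 := by
    have e1 : ∀ z, Complex.exp z = a z + z * deriv a z := by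
      intro z
      have h1 : HasDerivAt Complex.exp (1 * a z + (z - 0) * deriv a z) z := by
        have := (((hasDerivAt_id z).sub_const 0).mul (ha z).hasDerivAt).const_add (Complex.exp 0)
        refine this.congr_of_eventuallyEq (Filter.Eventually.of_forall fun w => ?_)
        simpa using ha1 w
      simpa using (Complex.hasDerivAt_exp z).unique h1
    have hda : Differentiable ℂ (deriv a) := by
      exact (ha.contDiff (n := 2)).differentiable_deriv_two
    have h1 : HasDerivAt Complex.exp (deriv a 0 + (1 * deriv a 0 + 0 * deriv (deriv a) 0)) 0 := by
      have := (ha 0).hasDerivAt.add ((hasDerivAt_id (0:ℂ)).mul (hda 0).hasDerivAt)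
      refine this.congr_of_eventuallyEq (Filter.Eventually.of_forall fun w => ?_)
      simpa using e1 w
    have h2 := (Complex.hasDerivAt_exp 0).unique h1
    simp at h2
    linear_combination -h2/2
  refine ⟨c, hc, fun z => ?_⟩
  have hA : a 0 = 1 := by rw [ha2]; simp
  rw [ha1 z, hb1 z, hc1 z, hA, hb2, hd]
  simp
  ring

lemma contour_s10 (H : ℂ → ℂ) (hd : ∀ z : ℂ, -1 < z.im → DifferentiableAt ℂ H z) (C R0 : ℝ) (hC : 0 ≤ C)
    (hb : ∀ z : ℂ, 0 ≤ z.im → R0 ≤ ‖z‖ → ‖H z‖ ≤ C / ‖z‖^2) :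
    Filter.Tendsto (fun R : ℝ => ∫ x in (-R)..R, H x) Filter.atTop (nhds 0) := by
  have key : ∀ R : ℝ, 0 < R → R0 ≤ R → ‖∫ x in (-R)..R, H x‖ ≤ (4*C) / R := by
    intro R hR hR0
    have hbd : ∀ z : ℂ, 0 ≤ z.im → R ≤ ‖z‖ → ‖H z‖ ≤ C / R^2 := by
      intro z h1 h2
      refine (hb z h1 (hR0.trans h2)).trans ?_
      gcongr
    have h := Complex.integral_boundary_rect_eq_zero_of_continuousOn_of_differentiableOn H
      (⟨-R, 0⟩ : ℂ) (⟨R, R⟩ : ℂ) ?_ ?_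
    · simp only [Complex.ofReal_zero, zero_mul, add_zero] at h
      have n1 : ‖∫ x : ℝ in (-R)..R, H (x + R * Complex.I)‖ ≤ C / R^2 * |R - (-R)| := by
        apply intervalIntegral.norm_integral_le_of_norm_le_const
        intro x hx
        apply hbd
        · simp [hR.le]
        · have := Complex.abs_im_le_norm (x + R * Complex.I)
          simpa [abs_of_pos hR] using this
      have n2 : ‖∫ y : ℝ in (0:ℝ)..R, H (R + y * Complex.I)‖ ≤ C / R^2 * |R - 0| := by
        apply intervalIntegral.norm_integral_le_of_norm_le_const
        intro x hx
        rw [Set.uIoc_of_le hR.le] at hx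
        apply hbd
        · simp [hx.1.le]
        · have := Complex.abs_re_le_norm (R + x * Complex.I)
          simpa [abs_of_pos hR] using this
      have n3 : ‖∫ y : ℝ in (0:ℝ)..R, H (((-R : ℝ) : ℂ) + y * Complex.I)‖ ≤ C / R^2 * |R - 0| := by
        apply intervalIntegral.norm_integral_le_of_norm_le_const
        intro x hx
        rw [Set.uIoc_of_le hR.le] at hx
        apply hbd
        · simp [hx.1.le]
        · have := Complex.abs_re_le_norm (((-R : ℝ) : ℂ) + x * Complex.I)
          simpa [abs_of_pos hR] using this
      have e : (∫ x : ℝ in (-R)..R, H x) = (∫ x : ℝ in (-R)..R, H (x + R * Complex.I))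
         - Complex.I • (∫ y : ℝ in (0:ℝ)..R, H (R + y * Complex.I))
         + Complex.I • (∫ y : ℝ in (0:ℝ)..R, H (((-R : ℝ) : ℂ) + y * Complex.I)) := by
        linear_combination h
      rw [e]
      refine (norm_add_le _ _).trans ?_
      refine (add_le_add_left (norm_sub_le _ _) _).trans ?_
      rw [norm_smul, norm_smul, Complex.norm_I, one_mul, one_mul]
      have e2 : C / R^2 * |R - (-R)| + C / R^2 * |R - 0| + C / R^2 * |R - 0| = 4 * C / R := by
        rw [abs_of_pos (by linarith), abs_of_pos (by linarith)]
        field_simp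
        ring
      linarith
    · intro z hz
      apply (hd z _).continuousAt.continuousWithinAt
      have := hz.2
      simp [Set.uIcc_of_le hR.le] at this
      linarith [this.1]
    · intro z hz
      apply (hd z _).differentiableWithinAt
      have := hz.2
      simp [hR.le] at this
      linarith [this.1]
  apply squeeze_zero_norm' (a := fun R : ℝ => (4*C)/R)
  · filter_upwards [Filter.eventually_gt_atTop 0, Filter.eventually_ge_atTop R0] with R h1 h2
    exact key R h1 h2
  · exact Filter.Tendsto.const_div_atTop Filter.tendsto_id _

lemma exists_H (τ σ lam : ℝ) (hτ : 0 < τ) (hσ : 0 < σ) (hlam : τ < lam) (c : ℝ)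
    (hc : c = 3*lam^2/4 * (Real.sin σ / σ) + τ^2*(σ * Real.cos σ - Real.sin σ)/(4*σ^3)) :
    ∃ (H : ℂ → ℂ) (C R0 : ℝ), (∀ z : ℂ, -1 < z.im → DifferentiableAt ℂ H z) ∧ 0 ≤ C ∧
      (∀ z : ℂ, 0 ≤ z.im → R0 ≤ ‖z‖ → ‖H z‖ ≤ C / ‖z‖^2) ∧
      ∀ x : ℝ, x ≠ 0 → (H x).im + c * (1 + x^2)⁻¹ = 
        (Real.sin (Real.sqrt (τ ^ 2 * x ^ 2 + σ ^ 2)) /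
            Real.sqrt (τ ^ 2 * x ^ 2 + σ ^ 2)) *
          ((Real.sin (lam * x)) ^ 3 / x ^ 3) := by
  obtain ⟨S, hS, hSs⟩ := exists_S
  obtain ⟨e, he, hee⟩ := exists_exp3
  obtain ⟨a, ha, ha1, ha2⟩ := exists_two S hS (σ^2)
  obtain ⟨b, hb, hb1, hb2⟩ := exists_two a ha (σ^2)
  have hσc : (σ:ℂ) ≠ 0 := by exact_mod_cast hσ.ne'
  have hf0 : S (σ^2) = Complex.sin σ / σ := by rw [eq_div_iff hσc, hSs]
  have hq : deriv S (σ^2) = (σ * Complex.cos σ - Complex.sin σ) / (2*σ^3) := by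
    have h1 : HasDerivAt (fun s : ℂ => S (s^2) * s) (deriv S (σ^2) * (2*σ) * σ + S (σ^2) * 1) (σ:ℂ) := by
      have h2 : HasDerivAt (fun s : ℂ => s^2) (2*σ) (σ:ℂ) := by
        simpa using hasDerivAt_pow 2 (σ:ℂ)
      exact ((hS _).hasDerivAt.comp (σ:ℂ) h2).mul (hasDerivAt_id _)
    rw [funext hSs] at h1
    have h3 := h1.unique (Complex.hasDerivAt_sin _)
    rw [hf0] at h3
    field_simp at h3 ⊢
    linear_combination h3
  set f : ℂ → ℂ := fun z => S (τ^2*z^2+σ^2) with hf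
  set E : ℂ → ℂ := fun z => (3 * Complex.exp (Complex.I*lam*z) - Complex.exp (3*(Complex.I*lam*z)))/4 with hE
  set E3 : ℂ → ℂ := fun z => (3 * (Complex.I*lam)^3 * e (Complex.I*lam*z)
    - 27 * (Complex.I*lam)^3 * e (3*(Complex.I*lam*z)))/4 with hE3
  have hEE : ∀ z, E z = 1/2 + 3/4*lam^2*z^2 + z^3*E3 z := by
    intro z
    simp only [hE, hE3]
    rw [hee (Complex.I*lam*z), hee (3*(Complex.I*lam*z))]
    linear_combination (-3/4*lam^2*z^2) * Complex.I_sq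
  set f0 : ℂ := S (σ^2)
  set q : ℂ := τ^2 * deriv S (σ^2) with hqd
  set K : ℂ → ℂ := fun z => τ^4 * b (τ^2*z^2+σ^2) with hK
  have hff : ∀ z, f z = f0 + q*z^2 + z^4*K z := by
    intro z
    simp only [hf, hK, hqd]
    rw [ha1, hb1, ha2]
    ring
  have hcc : (c:ℂ) = f0*(3/4*lam^2) + q/2 := by
    rw [hc, hqd, hq, hf0]
    push_cast
    field_simp
    ring
  set H : ℂ → ℂ := fun z => f0*E3 z + q*(3/4*lam^2*z+z^2*E3 z) + z*K z*E z + c/(z+Complex.I) with hH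
  have hHz : ∀ z, z ≠ 0 → z + Complex.I ≠ 0 → 
      H z = f z * E z / z^3 - (f0/2)/z^3 - c * Complex.I / (z*(z+Complex.I)) := by
    intro z h1 h2
    simp only [hH]
    rw [hff, div_sub_div_same, eq_sub_iff_add_eq]
    have : (c:ℂ)/(z+Complex.I) + c*Complex.I/(z*(z+Complex.I)) = c / z := by
      field_simp
    rw [add_assoc, this, hEE, hcc]
    field_simp
    ring
  have himI : ∀ z : ℂ, -1 < z.im → z + Complex.I ≠ 0 := by
    intro z hz h
    have := congrArg Complex.im h
    simp at this
    linarith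
  have hfs : ∀ z s : ℂ, s^2 = τ^2*z^2+σ^2 → s ≠ 0 → f z = Complex.sin s / s := by
    intro z s h1 h2
    rw [eq_div_iff h2, ← hSs s, h1]
  refine ⟨H, 1 + ‖f0/2‖ + ‖(c:ℂ)‖, 1 + (1+σ^2)/τ^2, ?_, by positivity, ?_, ?_⟩
  · intro z hz
    have := himI z hz
    have dE3 : Differentiable ℂ E3 := by
      simp only [hE3]; fun_prop
    have dE : Differentiable ℂ E := by
      simp only [hE]; fun_prop
    have dK : Differentiable ℂ K := by
      simp only [hK]; fun_prop
    simp only [hH]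
    fun_prop (disch := assumption)
  · intro z hz hR
    have hn1 : 1 ≤ ‖z‖ := le_trans (by have : 0 ≤ (1+σ^2)/τ^2 := by positivity
                                       linarith) hR
    have hz0 : z ≠ 0 := by rintro rfl; simp at hn1; linarith
    rw [hHz z hz0 (himI z (by linarith))]
    have b1 : ‖f z * E z‖ ≤ 1 := by
      obtain ⟨s, hs⟩ : ∃ s : ℂ, s^2 = τ^2*z^2+σ^2 := IsAlgClosed.exists_pow_nat_eq _ (by norm_num)
      have hs1 : 1 ≤ ‖s‖ := by
        have h1 : ‖(τ^2*z^2 : ℂ)‖ ≤ ‖s^2‖ + ‖(σ^2:ℂ)‖ := by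
          have : (τ^2*z^2 : ℂ) = s^2 - σ^2 := by rw [hs]; ring
          rw [this]; exact norm_sub_le _ _
        simp only [norm_mul, norm_pow, Complex.norm_real, Real.norm_eq_abs, sq_abs] at h1
        have h2 : (1+σ^2)/τ^2 ≤ ‖z‖^2 := by nlinarith
        rw [div_le_iff₀ (by positivity)] at h2
        nlinarith [norm_nonneg s]
      have hs0 : s ≠ 0 := by rintro rfl; simp at hs1; linarith
      rw [hfs z s hs hs0, norm_mul, norm_div]
      have h3 : ‖Complex.sin s‖/‖s‖ ≤ Real.exp (τ * z.im) := by
        have h4 := norm_sin_le' s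
        have h5 := im_bound τ σ hτ hσ z s hs
        rw [abs_of_nonneg hz] at h5
        have h6 := Real.exp_le_exp.2 h5
        exact (div_le_self (norm_nonneg _) hs1).trans (h4.trans h6)
      have h7 : ‖E z‖ ≤ Real.exp (-lam * z.im) := by
        have h8 : ‖Complex.exp (Complex.I*lam*z)‖ = Real.exp (-lam * z.im) := by
          rw [Complex.norm_exp]; simp
        have h9 : ‖Complex.exp (3*(Complex.I*lam*z))‖ ≤ Real.exp (-lam * z.im) := by
          rw [Complex.norm_exp]; apply Real.exp_le_exp.2; simp
          nlinarith [mul_nonneg (hτ.trans hlam).le hz]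
        simp only [hE]
        rw [norm_div, Complex.norm_ofNat]
        have := norm_sub_le (3 * Complex.exp (Complex.I*lam*z)) (Complex.exp (3*(Complex.I*lam*z)))
        rw [norm_mul, h8, Complex.norm_ofNat] at this
        linarith
      calc _ ≤ Real.exp (τ * z.im) * Real.exp (-lam * z.im) := by gcongr
        _ = Real.exp (-((lam-τ) * z.im)) := by rw [← Real.exp_add]; ring_nf
        _ ≤ 1 := by 
          apply Real.exp_le_one_iff.2
          have := mul_nonneg (sub_nonneg.2 hlam.le) hz
          linarith
    have hcube : ∀ A : ℝ, 0 ≤ A → A / ‖z‖^3 ≤ A / ‖z‖^2 := by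
      intro A hA
      apply div_le_div_of_nonneg_left hA (by positivity)
      exact pow_le_pow_right₀ hn1 (by norm_num)
    have hzI : ‖z‖ ≤ ‖z + Complex.I‖ := by
      rw [Complex.norm_def, Complex.norm_def]
      apply Real.sqrt_le_sqrt
      simp [Complex.normSq_apply]
      nlinarith
    refine (norm_sub_le _ _).trans ((add_le_add_left (norm_sub_le _ _) _).trans ?_)
    rw [norm_div _ (z^3), norm_div _ (z^3), norm_div (_ * Complex.I), norm_pow, norm_mul z, norm_mul (c:ℂ), Complex.norm_I, mul_one]
    rw [add_div, add_div]
    gcongr ?_ + ?_ + ?_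
    · exact (div_le_div_of_nonneg_right b1 (by positivity)).trans (hcube 1 zero_le_one)
    · exact hcube _ (norm_nonneg _)
    · apply div_le_div_of_nonneg_left (norm_nonneg _) (by positivity)
      nlinarith
  · intro x hx
    have hxc : (x:ℂ) ≠ 0 := by exact_mod_cast hx
    rw [hHz x hxc (himI x (by simp))]
    set s := Real.sqrt (τ ^ 2 * x ^ 2 + σ ^ 2) with hs
    have hspos : 0 < s := Real.sqrt_pos.2 (by positivity)
    have hfx : f x = ((Real.sin s / s : ℝ) : ℂ) := by
      rw [hfs x s (by
        have : s^2 = τ ^ 2 * x ^ 2 + σ ^ 2 := Real.sq_sqrt (by positivity)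
        exact_mod_cast this) (by exact_mod_cast hspos.ne')]
      push_cast; rfl
    have hEx : (E x).im = (Real.sin (lam*x))^3 := by
      have e1 : Complex.I*lam*x = ((lam*x : ℝ):ℂ) * Complex.I := by push_cast; ring
      have e2 : 3*(((lam*x : ℝ):ℂ) * Complex.I) = ((3*(lam*x) : ℝ):ℂ) * Complex.I := by push_cast; ring
      have e3 : E x = ((1/4:ℝ):ℂ) * (((3:ℝ):ℂ) * Complex.exp (((lam*x : ℝ):ℂ) * Complex.I) 
          - Complex.exp (((3*(lam*x) : ℝ):ℂ) * Complex.I)) := by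
        simp only [hE]; rw [e1, e2]; push_cast; ring
      rw [e3, Complex.im_ofReal_mul, Complex.sub_im, Complex.im_ofReal_mul,
        Complex.exp_ofReal_mul_I_im, Complex.exp_ofReal_mul_I_im, Real.sin_three_mul]
      ring
    have t1 : (f x * E x / (x:ℂ)^3).im = Real.sin s / s * ((Real.sin (lam*x))^3 / x^3) := by
      have : f x * E x / (x:ℂ)^3 = ((Real.sin s / s / x^3 : ℝ) : ℂ) * E x := by
        rw [hfx]; push_cast; ring
      rw [this, Complex.im_ofReal_mul, hEx]
      ring
    have t2 : (f0 / 2 / (x:ℂ)^3).im = 0 := by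
      have : f0 / 2 / (x:ℂ)^3 = ((Real.sin σ / σ / 2 / x^3 : ℝ) : ℂ) := by
        rw [hf0]; push_cast; rfl
      rw [this, Complex.ofReal_im]
    have t3 : ((c:ℂ) * Complex.I / (x * (x + Complex.I))).im = c * (1 + x^2)⁻¹ := by
      have hxI := himI x (by simp)
      have hx2 : (1 + (x:ℂ)^2) ≠ 0 := by
        have : 1 + x^2 ≠ 0 := by positivity
        exact_mod_cast this
      have : (c:ℂ) * Complex.I / (x * (x + Complex.I))
          = ((c / (x * (1+x^2)) : ℝ) : ℂ) + ((c * (1+x^2)⁻¹ : ℝ) : ℂ) * Complex.I := by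
        push_cast
        field_simp
        linear_combination (-(c:ℂ) * x) * Complex.I_sq
      rw [this, Complex.add_im, Complex.ofReal_im, Complex.im_ofReal_mul, Complex.I_im]
      ring
    rw [Complex.sub_im, Complex.sub_im, t1, t2, t3]
    ring

/-- Example of Theorem 2 with `m = 1`: explicit evaluation of the Sinc transform of
`sin(√(τ²x² + σ²))/√(τ²x² + σ²)` with kernel `sin³(λx)/x³` for `λ > τ`. -/
theorem sinc_transform_example_odd
    (τ σ lam : ℝ) (hτ : 0 < τ) (hσ : 0 < σ) (hlam : τ < lam) :
    (∫ x in Set.Ioi (0 : ℝ),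
        (Real.sin (Real.sqrt (τ ^ 2 * x ^ 2 + σ ^ 2)) /
            Real.sqrt (τ ^ 2 * x ^ 2 + σ ^ 2)) *
          ((Real.sin (lam * x)) ^ 3 / x ^ 3))
      = (Real.pi * τ ^ 2 / (8 * σ ^ 3)) * (σ * Real.cos σ - Real.sin σ) +
          (3 * Real.pi * lam ^ 2 / (8 * σ)) * Real.sin σ := by
  obtain ⟨c, hc⟩ : ∃ c : ℝ, c = 3*lam^2/4 * (Real.sin σ / σ) +
    τ^2*(σ * Real.cos σ - Real.sin σ)/(4*σ^3) := ⟨_, rfl⟩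
  obtain ⟨H, C, R0, hd, hC, hb, hH⟩ := exists_H τ σ lam hτ hσ hlam c hc
  have hcont := contour_s10 H hd C R0 hC hb
  have hHc : Continuous (fun x : ℝ => H x) := by
    rw [continuous_iff_continuousAt]
    intro x
    exact (hd x (by simp)).continuousAt.comp Complex.continuous_ofReal.continuousAt
  have hic : Continuous (fun x : ℝ => c * (1 + x^2)⁻¹) := by
    refine continuous_const.mul (Continuous.inv₀ (by fun_prop) fun x => by positivity)
  have hIm : Continuous (fun x : ℝ => (H x).im) := Complex.continuous_im.comp hHc
  set G : ℝ → ℝ := fun x => (H x).im + c * (1 + x^2)⁻¹ with hG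
  have hGc : Continuous G := hIm.add hic
  have heven : ∀ x, G (-x) = G x := by
    intro x
    by_cases hx : x = 0
    · simp [hx]
    · simp only [hG]
      rw [hH x hx, hH (-x) (neg_ne_zero.2 hx)]
      simp only [even_two, Even.neg_pow, mul_neg, Real.sin_neg, Odd.neg_pow (by decide : Odd 3), neg_div_neg_eq]
  have hint : IntegrableOn G (Set.Ioi 0) := by
    apply Integrable.add
    · refine IntegrableOn.mono_set ?_ Set.Ioi_subset_Ici_self
      refine (hIm.locallyIntegrable.locallyIntegrableOn _).integrableOn_of_isBigO_atTop
        (g := fun x : ℝ => x^(-2:ℝ)) ?_ ⟨Set.Ioi 1, Filter.Ioi_mem_atTop 1, integrableOn_Ioi_rpow_of_lt (by norm_num) one_pos⟩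
      refine Asymptotics.IsBigO.of_bound C ?_
      filter_upwards [Filter.eventually_gt_atTop 0, Filter.eventually_ge_atTop R0] with x h1 h2
      have h3 := hb x (by simp) (by simpa [abs_of_pos h1] using h2)
      have h4 := Complex.abs_im_le_norm (H x)
      rw [Real.norm_eq_abs, Real.norm_of_nonneg (by positivity), Real.rpow_neg h1.le]
      simp at h3
      norm_cast
      rw [div_eq_mul_inv] at h3
      linarith
    · exact (integrable_inv_one_add_sq.const_mul c).integrableOn
  have hlim1 : Filter.Tendsto (fun R : ℝ => ∫ x in (0:ℝ)..R, G x) Filter.atTop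
      (nhds (∫ x in Set.Ioi 0, G x)) :=
    intervalIntegral_tendsto_integral_Ioi 0 hint Filter.tendsto_id
  have hlim2 : Filter.Tendsto (fun R : ℝ => ∫ x in (0:ℝ)..R, G x) Filter.atTop
      (nhds (c * (Real.pi/2))) := by
    have e : ∀ R : ℝ, ∫ x in (0:ℝ)..R, G x = (∫ x in (-R)..R, H x).im / 2 + c * Real.arctan R := by
      intro R
      have h1 : ∫ x in (-R)..0, G x = ∫ x in (0:ℝ)..R, G x := by
        have := intervalIntegral.integral_comp_neg (a := 0) (b := R) G
        simp only [heven, neg_zero] at this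
        exact this.symm
      have h2 := intervalIntegral.integral_add_adjacent_intervals
        (hGc.intervalIntegrable (μ := volume) (-R) 0) (hGc.intervalIntegrable (μ := volume) 0 R)
      have h3 : ∫ x in (-R)..R, G x = (∫ x in (-R)..R, (H x).im) + c * (2 * Real.arctan R) := by
        simp only [hG]
        rw [intervalIntegral.integral_add (hIm.intervalIntegrable _ _) (hic.intervalIntegrable _ _),
          intervalIntegral.integral_const_mul, integral_inv_one_add_sq, Real.arctan_neg]
        ring
      have h4 : ∫ x in (-R)..R, (H x).im = (∫ x in (-R)..R, H x).im := by
        have := Complex.imCLM.intervalIntegral_comp_comm (hHc.intervalIntegrable (μ := volume) (-R) R)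
        simpa using this
      rw [h4] at h3
      linarith
    simp_rw [e]
    have h1 : Filter.Tendsto (fun R : ℝ => (∫ x in (-R)..R, H x).im / 2) Filter.atTop (nhds 0) := by
      have := ((Complex.continuous_im.tendsto 0).comp hcont).div_const 2
      simpa using this
    have h2 := (Real.tendsto_arctan_atTop.mono_right nhdsWithin_le_nhds).const_mul c
    simpa using h1.add h2
  have := tendsto_nhds_unique hlim1 hlim2
  have hfin : (∫ x in Set.Ioi (0 : ℝ),
        (Real.sin (Real.sqrt (τ ^ 2 * x ^ 2 + σ ^ 2)) /
            Real.sqrt (τ ^ 2 * x ^ 2 + σ ^ 2)) *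
          ((Real.sin (lam * x)) ^ 3 / x ^ 3)) = ∫ x in Set.Ioi 0, G x := by
    apply setIntegral_congr_fun measurableSet_Ioi
    intro x hx
    exact (hH x (ne_of_gt hx)).symm
  rw [hfin, this, hc]
  field_simp
  ring
end
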